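/- arXiv:gr-qc/0504081 — 3 statements merged into one kernel-verified Lean document; each statement's English description precedes it below -/
import Mathlib

section
/- Let R₀ > 0 and let u be harmonic on the exterior region {x ∈ ℝ³ : ‖x‖ > R₀} with u(x) → 1 as ‖x‖ → ∞. Then there exist a real number m, a constant C ≥ 0, and a radius R₁ > R₀ such that |u(x) − 1 + m/‖x‖| ≤ C‖x‖⁻² for all x with ‖x‖ ≥ R₁. In particular, m = lim_{‖x‖→∞} ‖x‖(1 − u(x)). -/
open Filter

/-- Euclidean 3-space. -/
noncomputable abbrev E3 := EuclideanSpace ℝ (Fin 3)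

/-- The Laplacian of `u : E3 → ℝ` at `x`: the trace of the Hessian, computed as the sum of
the pure second derivatives in the standard coordinate directions. -/
noncomputable def laplacian (u : E3 → ℝ) (x : E3) : ℝ :=
  ∑ i : Fin 3, iteratedFDeriv ℝ 2 u x ![EuclideanSpace.single i 1, EuclideanSpace.single i 1]

/-- `u` is harmonic on `Ω`: it is `C²` on `Ω` and its Laplacian vanishes on `Ω`. -/
def HarmonicOn (u : E3 → ℝ) (Ω : Set E3) : Prop :=
  ContDiffOn ℝ 2 u Ω ∧ ∀ x ∈ Ω, laplacian u x = 0

open Topology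

section SecondDerivative

variable {E : Type*} [NormedAddCommGroup E] [NormedSpace ℝ E]

/-- The second derivative of a `C²` function along a line, as a value of the Hessian. -/
theorem iteratedFDeriv_two_eq_of_hasDerivAt_line {f : E → ℝ} {x v : E} {g : ℝ → ℝ} {c : ℝ}
    (hf : ContDiffAt ℝ 2 f x)
    (hg : ∀ᶠ t in 𝓝 (0 : ℝ), HasDerivAt (fun s : ℝ => f (x + s • v)) (g t) t)
    (hc : HasDerivAt g c 0) :
    iteratedFDeriv ℝ 2 f x ![v, v] = c := by
  have hline : ∀ t : ℝ, HasDerivAt (fun s : ℝ => x + s • v) v t := fun t => by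
    simpa using ((hasDerivAt_id t).smul_const v).const_add x
  have htend : Tendsto (fun s : ℝ => x + s • v) (𝓝 0) (𝓝 x) := by
    simpa using (hline 0).continuousAt.tendsto
  have hdiff : ∀ᶠ t in 𝓝 (0 : ℝ), DifferentiableAt ℝ f (x + t • v) :=
    htend.eventually ((hf.eventually (by simp)).mono fun y hy => hy.differentiableAt (by simp))
  have heq : (fun t : ℝ => fderiv ℝ f (x + t • v) v) =ᶠ[𝓝 0] g := by
    filter_upwards [hg, hdiff] with t h1 h2
    exact (h2.hasFDerivAt.comp_hasDerivAt t (hline t)).unique h1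
  have hf2 : HasFDerivAt (fderiv ℝ f) (fderiv ℝ (fderiv ℝ f) x) (x + (0 : ℝ) • v) := by
    simpa using ((hf.fderiv_right (m := 1) (by norm_num)).differentiableAt (by simp)).hasFDerivAt
  have h3 : HasDerivAt (fun t : ℝ => fderiv ℝ f (x + t • v) v)
      (fderiv ℝ (fderiv ℝ f) x v v) 0 := by
    have hA : HasDerivAt (fun t : ℝ => fderiv ℝ f (x + t • v))
        (fderiv ℝ (fderiv ℝ f) x v) 0 := hf2.comp_hasDerivAt (0 : ℝ) (hline 0)
    refine (hA.clm_apply (hasDerivAt_const (0 : ℝ) v)).congr_deriv ?_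
    rw [map_zero, add_zero]
  rw [iteratedFDeriv_two_apply]
  simpa using h3.unique (hc.congr_of_eventuallyEq heq)

/-- The Hessian is negative semidefinite at a local maximum. -/
theorem IsLocalMax.iteratedFDeriv_two_nonpos {f : E → ℝ} {x : E} (h : IsLocalMax f x)
    (hf : ContDiffAt ℝ 2 f x) (v : E) : iteratedFDeriv ℝ 2 f x ![v, v] ≤ 0 := by
  have hline : ∀ t : ℝ, HasDerivAt (fun s : ℝ => x + s • v) v t := fun t => by
    simpa using ((hasDerivAt_id t).smul_const v).const_add x
  have htend : Tendsto (fun s : ℝ => x + s • v) (𝓝 0) (𝓝 x) := by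
    simpa using (hline 0).continuousAt.tendsto
  have hcd : ContDiffAt ℝ 2 (fun s : ℝ => f (x + s • v)) 0 :=
    ContDiffAt.comp (0 : ℝ) (g := f) (f := fun s : ℝ => x + s • v)
      (by simpa using hf) (by fun_prop)
  have hmax : IsLocalMax (fun s : ℝ => f (x + s • v)) 0 := by
    simpa [IsLocalMax, IsMaxFilter] using htend.eventually h
  have hdd : HasDerivAt (deriv (fun s : ℝ => f (x + s • v)))
      (deriv (deriv (fun s : ℝ => f (x + s • v))) 0) 0 :=
    (((hcd.derivWithin (m := 1) (by norm_num)).differentiableAt (by simp))).hasDerivAt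
  rw [iteratedFDeriv_two_eq_of_hasDerivAt_line hf
    ((hcd.eventually (by simp)).mono fun t ht => (ht.differentiableAt (by simp)).hasDerivAt) hdd]
  by_contra! hpos
  have hmin := isLocalMin_of_deriv_deriv_pos hpos hmax.deriv_eq_zero hcd.continuousAt
  have hconst : (fun s : ℝ => f (x + s • v)) =ᶠ[𝓝 0] fun _ => f (x + (0 : ℝ) • v) := by
    filter_upwards [hmin, hmax] with t h1 h2 using le_antisymm h2 h1
  have := hconst.deriv.deriv_eq
  simp at this
  linarith

end SecondDerivative

section MaximumPrinciple

variable {E : Type*} [NormedAddCommGroup E] [InnerProductSpace ℝ E]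

theorem hasDerivAt_inner_line (x v n : E) (t : ℝ) :
    HasDerivAt (fun s : ℝ => inner ℝ (x + s • v) n) (inner ℝ v n) t := by
  have h : HasDerivAt (fun s : ℝ => x + s • v) v t := by
    simpa using ((hasDerivAt_id t).smul_const v).const_add x
  simpa using h.inner ℝ (hasDerivAt_const t n)

theorem hasDerivAt_norm_sq_line (x v : E) (t : ℝ) :
    HasDerivAt (fun s : ℝ => ‖x + s • v‖ ^ 2) (2 * inner ℝ (x + t • v) v) t := by
  have h : HasDerivAt (fun s : ℝ => x + s • v) v t := by
    simpa using ((hasDerivAt_id t).smul_const v).const_add x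
  simpa using h.norm_sq

variable [FiniteDimensional ℝ E]

theorem laplacian_norm_sq (x : E) :
    Laplacian.laplacian (fun y : E => ‖y‖ ^ 2) x = 2 * Module.finrank ℝ E := by
  have h : ∀ v : E, iteratedFDeriv ℝ 2 (fun y : E => ‖y‖ ^ 2) x ![v, v] = 2 * inner ℝ v v :=
    fun v => iteratedFDeriv_two_eq_of_hasDerivAt_line (contDiff_norm_sq ℝ).contDiffAt
      (Eventually.of_forall fun t => hasDerivAt_norm_sq_line x v t)
      ((hasDerivAt_inner_line x v v 0).const_mul 2)
  simp [InnerProductSpace.laplacian_eq_iteratedFDeriv_stdOrthonormalBasis, h, mul_comm]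

/-- Maximum principle on a closed, possibly unbounded set, for functions vanishing at infinity. -/
theorem nonpos_of_harmonicAt_of_tendsto_zero [Nontrivial E] {S : Set E} {w : E → ℝ}
    (hS : IsClosed S) (hw : ContinuousOn w S)
    (h : ∀ x ∈ S, w x ≤ 0 ∨ (S ∈ 𝓝 x ∧ InnerProductSpace.HarmonicAt w x))
    (hlim : Tendsto w (cocompact E) (𝓝 0)) {x : E} (hx : x ∈ S) : w x ≤ 0 := by
  by_contra! hpos
  rw [← Metric.cobounded_eq_cocompact] at hlim
  obtain ⟨ρ, -, hρ⟩ := (hasBasis_cobounded_norm (E := E)).eventually_iff.1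
    (hlim.eventually_lt_const (half_pos hpos))
  simp only [Set.mem_ofPred_eq] at hρ
  have hxρ : ‖x‖ ≤ ρ := by
    by_contra! hlt
    have := hρ hlt.le
    linarith
  set ε : ℝ := w x / (2 * (ρ ^ 2 + 1)) with hε
  have hε0 : 0 < ε := by positivity
  have hερ : ε * ρ ^ 2 < w x / 2 := by
    have : ε * (ρ ^ 2 + 1) = w x / 2 := by rw [hε]; field_simp
    linarith
  have hK : IsCompact (S ∩ Metric.closedBall 0 ρ) :=
    (isCompact_closedBall 0 ρ).inter_left hS
  obtain ⟨z, ⟨hzS, hzρ⟩, hz⟩ := hK.exists_isMaxOn ⟨x, hx, by simpa using hxρ⟩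
    (f := w + ε • fun y : E => ‖y‖ ^ 2)
    ((hw.mono Set.inter_subset_left).add (by fun_prop))
  have hzx := hz ⟨hx, by simpa using hxρ⟩
  simp only [Pi.add_apply, Pi.smul_apply, smul_eq_mul, Set.mem_ofPred_eq] at hzx
  rw [mem_closedBall_zero_iff] at hzρ
  have hwz : w x / 2 < w z := by
    have h1 : ε * ‖z‖ ^ 2 ≤ ε * ρ ^ 2 := by gcongr
    have h2 : 0 ≤ ε * ‖x‖ ^ 2 := by positivity
    linarith
  have hzlt : ‖z‖ < ρ := by
    by_contra! hle
    have := hρ hle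
    linarith
  rcases h z hzS with h0 | ⟨hnhds, hharm⟩
  · linarith
  have hmax : IsLocalMax (w + ε • fun y : E => ‖y‖ ^ 2) z :=
    hz.isLocalMax (inter_mem hnhds (mem_of_superset
      (Metric.isOpen_ball.mem_nhds (by simpa using hzlt)) Metric.ball_subset_closedBall))
  have hsq : ContDiffAt ℝ 2 (fun y : E => ‖y‖ ^ 2) z := (contDiff_norm_sq ℝ).contDiffAt
  have hsq' : ContDiffAt ℝ 2 (ε • fun y : E => ‖y‖ ^ 2) z := hsq.const_smul ε
  have hΔ : Laplacian.laplacian (w + ε • fun y : E => ‖y‖ ^ 2) z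
      = ε * (2 * Module.finrank ℝ E) := by
    rw [hharm.1.laplacian_add hsq', InnerProductSpace.laplacian_smul ε hsq, laplacian_norm_sq,
      hharm.2.eq_of_nhds]
    simp
  have hle : Laplacian.laplacian (w + ε • fun y : E => ‖y‖ ^ 2) z ≤ 0 := by
    rw [InnerProductSpace.laplacian_eq_iteratedFDeriv_stdOrthonormalBasis]
    exact Finset.sum_nonpos fun i _ => hmax.iteratedFDeriv_two_nonpos (hharm.1.add hsq') _
  have hd : (0 : ℝ) < Module.finrank ℝ E := by exact_mod_cast Module.finrank_pos
  have : 0 < ε * (2 * (Module.finrank ℝ E : ℝ)) := by positivity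
  linarith

/-- Harmonicity is invariant under linear isometries of the domain. -/
theorem InnerProductSpace.HarmonicAt.comp_linearIsometryEquiv {f : E → ℝ} {x : E}
    (σ : E ≃ₗᵢ[ℝ] E) (h : InnerProductSpace.HarmonicAt f (σ x)) :
    InnerProductSpace.HarmonicAt (f ∘ σ) x := by
  refine ⟨h.1.comp x σ.contDiff.contDiffAt, ?_⟩
  have : Laplacian.laplacian (f ∘ σ) = Laplacian.laplacian f ∘ σ := by
    ext y
    rw [InnerProductSpace.laplacian_eq_iteratedFDeriv_stdOrthonormalBasis,
      InnerProductSpace.laplacian_eq_iteratedFDeriv_orthonormalBasis f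
        ((stdOrthonormalBasis ℝ E).map σ)]
    have h2 := σ.toContinuousLinearEquiv.iteratedFDerivWithin_comp_right f uniqueDiffOn_univ
      (x := y) (Set.mem_univ _) 2
    simp only [Set.preimage_univ, iteratedFDerivWithin_univ] at h2
    refine Finset.sum_congr rfl fun i _ => ?_
    have h3 := congrArg (fun L => L ![stdOrthonormalBasis ℝ E i, stdOrthonormalBasis ℝ E i]) h2
    refine h3.trans ?_
    simp only [ContinuousMultilinearMap.compContinuousLinearMap_apply]
    congr 1
    ext j
    fin_cases j <;> simp
  rw [this]
  exact σ.continuous.continuousAt.eventually h.2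

end MaximumPrinciple

section Barriers

theorem hasDerivAt_inv_norm_pow_line {E : Type*} [NormedAddCommGroup E] [InnerProductSpace ℝ E]
    (k : ℕ) {x v : E} {t : ℝ} (h : x + t • v ≠ 0) :
    HasDerivAt (fun s : ℝ => (‖x + s • v‖ ^ k)⁻¹)
      (-k * inner ℝ (x + t • v) v * (‖x + t • v‖ ^ (k + 2))⁻¹) t := by
  have h0 : ‖x + t • v‖ ≠ 0 := norm_ne_zero_iff.2 h
  have h1 : HasDerivAt (fun s : ℝ => ‖x + s • v‖) (inner ℝ (x + t • v) v / ‖x + t • v‖) t := by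
    have := (hasDerivAt_norm_sq_line x v t).sqrt (by positivity)
    simp only [Real.sqrt_sq (norm_nonneg _)] at this
    convert this using 1
    field_simp
  refine ((h1.fun_pow k).fun_inv (pow_ne_zero k h0)).congr_deriv ?_
  rcases k with _ | k
  · simp
  · simp only [Nat.add_sub_cancel]
    field_simp
    ring

theorem eventually_line_ne_zero {E : Type*} [NormedAddCommGroup E] [NormedSpace ℝ E] {x : E}
    (hx : x ≠ 0) (v : E) : ∀ᶠ t in 𝓝 (0 : ℝ), x + t • v ≠ 0 := by
  have h : ContinuousAt (fun t : ℝ => x + t • v) 0 := by fun_prop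
  exact h.eventually_ne (by simpa using hx)

theorem laplacian_eq_laplacian (f : E3 → ℝ) : laplacian f = Laplacian.laplacian f := by
  rw [InnerProductSpace.laplacian_eq_iteratedFDeriv_orthonormalBasis f
    (EuclideanSpace.basisFun (Fin 3) ℝ)]
  ext x
  simp [laplacian]

theorem HarmonicOn.harmonicAt {u : E3 → ℝ} {Ω : Set E3} (hΩ : IsOpen Ω) (hu : HarmonicOn u Ω)
    {x : E3} (hx : x ∈ Ω) : InnerProductSpace.HarmonicAt u x := by
  refine ⟨hu.1.contDiffAt (hΩ.mem_nhds hx), ?_⟩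
  filter_upwards [hΩ.mem_nhds hx] with y hy
  rw [← laplacian_eq_laplacian]
  exact hu.2 y hy

/-- The dipole potential `⟪x, n⟫ / ‖x‖³` is harmonic away from the origin. -/
theorem harmonicAt_inner_mul_inv_norm_pow_three (n : E3) {x : E3} (hx : x ≠ 0) :
    InnerProductSpace.HarmonicAt (fun y : E3 => inner ℝ y n * (‖y‖ ^ 3)⁻¹) x := by
  have hcd : ∀ {y : E3}, y ≠ 0 → ContDiffAt ℝ 2 (fun y : E3 => inner ℝ y n * (‖y‖ ^ 3)⁻¹) y :=
    fun {y} hy => (contDiffAt_id.inner ℝ contDiffAt_const).mul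
      (((contDiffAt_norm ℝ hy).pow 3).inv (pow_ne_zero _ (norm_ne_zero_iff.2 hy)))
  refine ⟨hcd hx, ?_⟩
  filter_upwards [isOpen_ne.mem_nhds hx] with y hy
  have hy0 : ‖y‖ ≠ 0 := norm_ne_zero_iff.2 hy
  have key : ∀ v : E3, iteratedFDeriv ℝ 2 (fun y : E3 => inner ℝ y n * (‖y‖ ^ 3)⁻¹) y ![v, v]
      = -6 * (inner ℝ v n * inner ℝ y v) * (‖y‖ ^ 5)⁻¹
        - 3 * inner ℝ y n * inner ℝ v v * (‖y‖ ^ 5)⁻¹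
        + 15 * inner ℝ y n * inner ℝ y v ^ 2 * (‖y‖ ^ 7)⁻¹ := by
    intro v
    refine iteratedFDeriv_two_eq_of_hasDerivAt_line (hcd hy)
      ((eventually_line_ne_zero hy v).mono fun t ht =>
        (hasDerivAt_inner_line y v n t).mul (hasDerivAt_inv_norm_pow_line 3 ht)) ?_
    have hy' : y + (0 : ℝ) • v ≠ 0 := by simpa using hy
    refine (((hasDerivAt_inv_norm_pow_line 3 hy').const_mul (inner ℝ v n)).add
      ((hasDerivAt_inner_line y v n 0).mul
        (((hasDerivAt_inner_line y v v 0).const_mul (-(3 : ℕ) : ℝ)).mul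
          (hasDerivAt_inv_norm_pow_line 5 hy')))).congr_deriv ?_
    simp
    ring
  rw [← laplacian_eq_laplacian]
  have hn : ‖y‖ ^ 2 = y 0 ^ 2 + y 1 ^ 2 + y 2 ^ 2 := by
    rw [EuclideanSpace.real_norm_sq_eq, Fin.sum_univ_three]
  simp only [laplacian, key, Fin.sum_univ_three, Pi.zero_apply]
  simp only [PiLp.inner_apply, Fin.sum_univ_three]
  simp
  field_simp
  rw [hn]
  ring

/-- The Newtonian potential is harmonic away from the origin. -/
theorem harmonicAt_inv_norm {x : E3} (hx : x ≠ 0) :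
    InnerProductSpace.HarmonicAt (fun y : E3 => (‖y‖ ^ 1)⁻¹) x := by
  have hcd : ∀ {y : E3}, y ≠ 0 → ContDiffAt ℝ 2 (fun y : E3 => (‖y‖ ^ 1)⁻¹) y :=
    fun {y} hy => ((contDiffAt_norm ℝ hy).pow 1).inv (pow_ne_zero _ (norm_ne_zero_iff.2 hy))
  refine ⟨hcd hx, ?_⟩
  filter_upwards [isOpen_ne.mem_nhds hx] with y hy
  have hy0 : ‖y‖ ≠ 0 := norm_ne_zero_iff.2 hy
  have key : ∀ v : E3, iteratedFDeriv ℝ 2 (fun y : E3 => (‖y‖ ^ 1)⁻¹) y ![v, v]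
      = - inner ℝ v v * (‖y‖ ^ 3)⁻¹ + 3 * inner ℝ y v ^ 2 * (‖y‖ ^ 5)⁻¹ := by
    intro v
    refine iteratedFDeriv_two_eq_of_hasDerivAt_line (hcd hy)
      ((eventually_line_ne_zero hy v).mono fun t ht => hasDerivAt_inv_norm_pow_line 1 ht) ?_
    have hy' : y + (0 : ℝ) • v ≠ 0 := by simpa using hy
    refine (((hasDerivAt_inner_line y v v 0).const_mul (-(1 : ℕ) : ℝ)).mul
          (hasDerivAt_inv_norm_pow_line 3 hy')).congr_deriv ?_
    simp
    ring
  rw [← laplacian_eq_laplacian]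
  have hn : ‖y‖ ^ 2 = y 0 ^ 2 + y 1 ^ 2 + y 2 ^ 2 := by
    rw [EuclideanSpace.real_norm_sq_eq, Fin.sum_univ_three]
  simp only [laplacian, key, Fin.sum_univ_three, Pi.zero_apply]
  simp [EuclideanSpace.inner_single_right]
  field_simp
  rw [hn]
  ring

end Barriers

section ExteriorDecay

theorem tendsto_inv_norm_pow_cocompact {k : ℕ} (hk : k ≠ 0) :
    Tendsto (fun x : E3 => (‖x‖ ^ k)⁻¹) (cocompact E3) (𝓝 0) :=
  ((tendsto_pow_atTop hk).comp tendsto_norm_cocompact_atTop).inv_tendsto_atTop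

/-- Comparison with the Newtonian potential: for a harmonic function vanishing at infinity, an
upper bound for `v x * ‖x‖` on a sphere propagates to the exterior of the sphere. -/
theorem mul_norm_le_of_forall_sphere {R r A : ℝ} {v : E3 → ℝ}
    (hv : ∀ x, R < ‖x‖ → InnerProductSpace.HarmonicAt v x)
    (hlim : Tendsto v (cocompact E3) (𝓝 0)) (hr : R < r) (hr0 : 0 < r)
    (hA : ∀ y, ‖y‖ = r → v y * ‖y‖ ≤ A) {x : E3} (hx : r ≤ ‖x‖) : v x * ‖x‖ ≤ A := by
  set w : E3 → ℝ := v - A • fun y : E3 => (‖y‖ ^ 1)⁻¹ with hw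
  have hharm : ∀ y, r ≤ ‖y‖ → InnerProductSpace.HarmonicAt w y := fun y hy =>
    (hv y (hr.trans_le hy)).sub
      (harmonicAt_inv_norm (norm_pos_iff.1 (hr0.trans_le hy))).const_smul
  have hwlim : Tendsto w (cocompact E3) (𝓝 0) := by
    simpa only [smul_zero, sub_zero] using!
      hlim.sub ((tendsto_inv_norm_pow_cocompact one_ne_zero).const_smul A)
  have hwx : w x ≤ 0 := by
    refine nonpos_of_harmonicAt_of_tendsto_zero (S := {y : E3 | r ≤ ‖y‖})
      (isClosed_le continuous_const continuous_norm)
      (fun y hy => (hharm y hy).1.continuousAt.continuousWithinAt) (fun y hy => ?_) hwlim hx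
    rcases (show r ≤ ‖y‖ from hy).eq_or_lt with h | h
    · left
      have hy0 : 0 < ‖y‖ := h ▸ hr0
      have := hA y h.symm
      simp only [hw, Pi.sub_apply, Pi.smul_apply, smul_eq_mul, pow_one, ← div_eq_mul_inv]
      rw [sub_nonpos, le_div_iff₀ hy0]
      exact this
    · right
      exact ⟨mem_of_superset ((isOpen_lt continuous_const continuous_norm).mem_nhds h)
        fun z hz => (show r < ‖z‖ from hz).le, hharm y hy⟩
  simp only [hw, Pi.sub_apply, Pi.smul_apply, smul_eq_mul, pow_one, ← div_eq_mul_inv] at hwx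
  rwa [sub_nonpos, le_div_iff₀ (hr0.trans_le hx)] at hwx

/-- The oscillation over spheres of a harmonic function vanishing at infinity decays
quadratically. Two points of a sphere are exchanged by a reflection, and the difference between the
function and its reflection is compared with a dipole potential on a half space. -/
theorem exists_sub_le_div_norm_sq {R r : ℝ} {v : E3 → ℝ}
    (hv : ∀ x, R < ‖x‖ → InnerProductSpace.HarmonicAt v x)
    (hlim : Tendsto v (cocompact E3) (𝓝 0)) (hr : R < r) (hr0 : 0 < r) :
    ∃ C : ℝ, 0 ≤ C ∧ ∀ x y : E3, r ≤ ‖x‖ → ‖x‖ = ‖y‖ → v x - v y ≤ C / ‖x‖ ^ 2 := by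
  obtain ⟨K, hK⟩ : ∃ K, LipschitzOnWith K v (Metric.sphere 0 r) := by
    refine LocallyLipschitzOn.exists_lipschitzOnWith_of_compact (isCompact_sphere 0 r)
      fun x hx => ?_
    obtain ⟨K, t, ht, hKt⟩ := ((hv x (by rw [mem_sphere_zero_iff_norm.1 hx]; exact hr)).1.of_le
      (by norm_num : (1 : WithTop ℕ∞) ≤ 2)).exists_lipschitzOnWith
    exact ⟨K, t, mem_nhdsWithin_of_mem_nhds ht, hKt⟩
  refine ⟨2 * K * r ^ 3, by positivity, fun x y hx hxy => ?_⟩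
  have hx0 : 0 < ‖x‖ := hr0.trans_le hx
  rcases eq_or_ne x y with rfl | hne
  · rw [sub_self]; positivity
  set n : E3 := x - y with hn
  have hn0 : 0 < ‖n‖ := norm_pos_iff.2 (sub_ne_zero.2 hne)
  set σ : E3 ≃ₗᵢ[ℝ] E3 := (ℝ ∙ n)ᗮ.reflection with hσ
  have hσx : σ x = y := Submodule.reflection_sub hxy
  have hσz : ∀ z, z - σ z = (2 * (inner ℝ z n / ‖n‖ ^ 2)) • n := fun z => by
    rw [hσ, Submodule.reflection_orthogonal_apply, Submodule.reflection_singleton_apply,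
      real_inner_comm]
    simp only [RCLike.ofReal_real_eq_id, id]
    module
  set a : ℝ := 2 * K * r ^ 3 / ‖n‖ with ha
  set w : E3 → ℝ := v - v ∘ σ - a • fun z : E3 => inner ℝ z n * (‖z‖ ^ 3)⁻¹ with hw
  have hharm : ∀ z, r ≤ ‖z‖ → InnerProductSpace.HarmonicAt w z := fun z hz => by
    refine ((hv z (hr.trans_le hz)).sub
      (InnerProductSpace.HarmonicAt.comp_linearIsometryEquiv σ (hv (σ z) ?_))).sub
      (harmonicAt_inner_mul_inv_norm_pow_three n (norm_pos_iff.1 (hr0.trans_le hz))).const_smul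
    rw [σ.norm_map]
    exact hr.trans_le hz
  have hdip : ∀ z : E3, |inner ℝ z n * (‖z‖ ^ 3)⁻¹| ≤ ‖n‖ * (‖z‖ ^ 2)⁻¹ := fun z => by
    rcases eq_or_ne z 0 with rfl | hz
    · simp
    have hz0 : 0 < ‖z‖ := norm_pos_iff.2 hz
    rw [abs_mul, abs_of_pos (inv_pos.2 (pow_pos hz0 3))]
    calc |inner ℝ z n| * (‖z‖ ^ 3)⁻¹ ≤ ‖z‖ * ‖n‖ * (‖z‖ ^ 3)⁻¹ := by
          gcongr
          exact abs_real_inner_le_norm z n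
      _ = ‖n‖ * (‖z‖ ^ 2)⁻¹ := by field_simp
  have hwlim : Tendsto w (cocompact E3) (𝓝 0) := by
    have h1 : Tendsto (v ∘ σ) (cocompact E3) (𝓝 0) :=
      hlim.comp σ.toHomeomorph.isClosedEmbedding.tendsto_cocompact
    have h2 : Tendsto (fun z : E3 => inner ℝ z n * (‖z‖ ^ 3)⁻¹) (cocompact E3) (𝓝 0) :=
      squeeze_zero_norm hdip
        (by simpa using (tendsto_inv_norm_pow_cocompact two_ne_zero).const_mul ‖n‖)
    simpa using! (hlim.sub h1).sub (h2.const_smul a)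
  have hxn : 0 ≤ inner ℝ x n := by
    have h1 : inner ℝ x y ≤ ‖x‖ * ‖y‖ := real_inner_le_norm x y
    rw [hn, inner_sub_right, real_inner_self_eq_norm_sq]
    rw [← hxy] at h1
    nlinarith
  have hcont : Continuous fun z : E3 => inner ℝ z n := by fun_prop
  have hwx : w x ≤ 0 := by
    refine nonpos_of_harmonicAt_of_tendsto_zero (S := {z : E3 | r ≤ ‖z‖ ∧ 0 ≤ inner ℝ z n})
      ((isClosed_le continuous_const continuous_norm).inter
        (isClosed_le continuous_const hcont))
      (fun z hz => (hharm z hz.1).1.continuousAt.continuousWithinAt) (fun z hz => ?_) hwlim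
      ⟨hx, hxn⟩
    obtain ⟨hz1, hz2⟩ : r ≤ ‖z‖ ∧ 0 ≤ inner ℝ z n := hz
    rcases hz2.eq_or_lt with h2 | h2
    · left
      have : σ z = z := by
        have h3 : z - σ z = 0 := by rw [hσz, ← h2]; simp
        exact (sub_eq_zero.1 h3).symm
      simp [hw, this, ← h2]
    rcases hz1.eq_or_lt with h1 | h1
    · left
      have hL := hK.dist_le_mul z (by simp [h1]) (σ z) (by simp [σ.norm_map, h1])
      rw [Real.dist_eq, dist_eq_norm, hσz, norm_smul, Real.norm_of_nonneg (by positivity)] at hL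
      have hL' := (le_abs_self _).trans hL
      simp only [hw, Pi.sub_apply, Pi.smul_apply, smul_eq_mul, Function.comp_apply, ← h1]
      refine sub_nonpos.2 (hL'.trans_eq ?_)
      rw [ha]
      field_simp
    · right
      exact ⟨mem_of_superset (((isOpen_lt continuous_const continuous_norm).inter
        (isOpen_lt continuous_const hcont)).mem_nhds ⟨h1, h2⟩)
        fun p hp => ⟨hp.1.le, hp.2.le⟩, hharm z hz1⟩
  simp only [hw, Pi.sub_apply, Pi.smul_apply, smul_eq_mul, Function.comp_apply, hσx] at hwx
  calc v x - v y ≤ a * (inner ℝ x n * (‖x‖ ^ 3)⁻¹) := sub_nonpos.1 hwx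
    _ ≤ a * (‖n‖ * (‖x‖ ^ 2)⁻¹) :=
        mul_le_mul_of_nonneg_left ((le_abs_self _).trans (hdip x)) (by positivity)
    _ = 2 * K * r ^ 3 / ‖x‖ ^ 2 := by
        rw [ha]
        field_simp

/-- A harmonic function vanishing at infinity is a multiple of the Newtonian potential up to an
error of second order. -/
theorem exists_tendsto_and_abs_sub_le {R r : ℝ} {v : E3 → ℝ}
    (hv : ∀ x, R < ‖x‖ → InnerProductSpace.HarmonicAt v x)
    (hlim : Tendsto v (cocompact E3) (𝓝 0)) (hr : R < r) (hr0 : 0 < r) :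
    ∃ L C : ℝ, 0 ≤ C ∧ Tendsto (fun x => v x * ‖x‖) (cocompact E3) (𝓝 L) ∧
      ∀ x, r ≤ ‖x‖ → |v x * ‖x‖ - L| ≤ C / ‖x‖ := by
  obtain ⟨C, hC, hosc⟩ := exists_sub_le_div_norm_sq hv hlim hr hr0
  have hcomp : ∀ x y : E3, r ≤ ‖x‖ → ‖x‖ ≤ ‖y‖ → |v x * ‖x‖ - v y * ‖y‖| ≤ C / ‖x‖ := by
    intro x y hx hxy
    have hx0 : 0 < ‖x‖ := hr0.trans_le hx
    have hmul : ∀ p q : E3, ‖p‖ = ‖x‖ → ‖q‖ = ‖x‖ → v p * ‖p‖ ≤ v q * ‖q‖ + C / ‖x‖ := by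
      intro p q hp hq
      have := mul_le_mul_of_nonneg_right (hosc p q (hp ▸ hx) (hp.trans hq.symm)) (norm_nonneg x)
      rw [hp] at this
      have h2 : C / ‖x‖ ^ 2 * ‖x‖ = C / ‖x‖ := by field_simp
      rw [hp, hq]
      linarith
    have hup := mul_norm_le_of_forall_sphere hv hlim (hr.trans_le hx) hx0
      (fun p hp => hmul p x hp rfl) hxy
    have hlow := mul_norm_le_of_forall_sphere (v := -v) (A := -(v x * ‖x‖) + C / ‖x‖)
      (fun z hz => (hv z hz).neg) (by simpa using! hlim.neg) (hr.trans_le hx) hx0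
      (fun p hp => by have := hmul x p rfl hp; simp only [Pi.neg_apply]; linarith) hxy
    simp only [Pi.neg_apply] at hlow
    rw [abs_le]
    constructor <;> linarith
  obtain ⟨L, hL⟩ : ∃ L, Tendsto (fun x => v x * ‖x‖) (cocompact E3) (𝓝 L) := by
    rw [← cauchy_map_iff_exists_tendsto, Metric.cauchy_iff]
    refine ⟨inferInstance, fun ε hε => ?_⟩
    set ρ := max r (C / ε + 1)
    have hρ : C / ρ < ε := by
      have h1 : C / ε + 1 ≤ ρ := le_max_right _ _
      have h2 : 0 < ρ := hr0.trans_le (le_max_left _ _)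
      rw [div_lt_comm₀ h2 hε]
      linarith
    have key : ∀ x y : E3, ρ ≤ ‖x‖ → ‖x‖ ≤ ‖y‖ → dist (v x * ‖x‖) (v y * ‖y‖) < ε := by
      intro x y hx hxy
      refine (hcomp x y ((le_max_left _ _).trans hx) hxy).trans_lt (lt_of_le_of_lt ?_ hρ)
      have h2 : 0 < ρ := hr0.trans_le (le_max_left _ _)
      gcongr
    refine ⟨_, image_mem_map (tendsto_norm_cocompact_atTop.eventually_ge_atTop ρ), ?_⟩
    rintro _ ⟨x, hx, rfl⟩ _ ⟨y, hy, rfl⟩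
    rcases le_total ‖x‖ ‖y‖ with h | h
    · exact key x y hx h
    · rw [dist_comm]
      exact key y x hy h
  refine ⟨L, C, hC, hL, fun x hx => ?_⟩
  exact le_of_tendsto (tendsto_const_nhds.sub hL).abs
    ((tendsto_norm_cocompact_atTop.eventually_ge_atTop ‖x‖).mono fun y hy => hcomp x y hx hy)

end ExteriorDecay

/-- A harmonic function on an exterior region of `ℝ³` tending to `1` at infinity has the
asymptotic expansion `u = 1 − m/|x| + O(|x|⁻²)`, with `m = lim ‖x‖(1 − u(x))`. -/
theorem harmonic_exterior_asymptotic_expansion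
    (R₀ : ℝ) (hR₀ : 0 < R₀) (u : E3 → ℝ)
    (hu : HarmonicOn u {x : E3 | R₀ < ‖x‖})
    (hlim : Tendsto u (Filter.cocompact E3) (nhds 1)) :
    ∃ (m C R₁ : ℝ), 0 ≤ C ∧ R₀ < R₁ ∧
      (∀ x : E3, R₁ ≤ ‖x‖ → |u x - 1 + m / ‖x‖| ≤ C * ‖x‖⁻¹ ^ 2) ∧
      Tendsto (fun x : E3 => ‖x‖ * (1 - u x)) (Filter.cocompact E3) (nhds m) := by
  have hv : ∀ x : E3, R₀ < ‖x‖ → InnerProductSpace.HarmonicAt (u - fun _ => (1 : ℝ)) x :=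
    fun x hx => (hu.harmonicAt (isOpen_lt continuous_const continuous_norm) hx).sub
      (InnerProductSpace.harmonicAt_const 1)
  obtain ⟨L, C, hC, hL, hbound⟩ := exists_tendsto_and_abs_sub_le hv
    (by simpa using! hlim.sub_const 1) (lt_add_one R₀) (by linarith)
  simp only [Pi.sub_apply] at hL hbound
  refine ⟨-L, C, R₀ + 1, hC, lt_add_one R₀, fun x hx => ?_, ?_⟩
  · have hx0 : 0 < ‖x‖ := by linarith
    have heq : u x - 1 + -L / ‖x‖ = ((u x - 1) * ‖x‖ - L) * ‖x‖⁻¹ := by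
      field_simp
      ring
    rw [heq, abs_mul, abs_of_pos (inv_pos.2 hx0)]
    calc |(u x - 1) * ‖x‖ - L| * ‖x‖⁻¹ ≤ C / ‖x‖ * ‖x‖⁻¹ := by
          gcongr
          exact hbound x hx
      _ = C * ‖x‖⁻¹ ^ 2 := by ring
  · refine hL.neg.congr fun x => ?_
    ring
end

section
/- Let R₀ > 0 and let u be harmonic on the exterior region {x ∈ ℝ³ : ‖x‖ > R₀} with u(x) → 1 as ‖x‖ → ∞, and let m = lim_{‖x‖→∞} ‖x‖(1 − u(x)) (which exists). Then there exist a constant C ≥ 0 and a radius R₁ > R₀ such that ‖∇u(x) − m·x/‖x‖³‖ ≤ C‖x‖⁻³ for all x with ‖x‖ ≥ R₁. -/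
open Filter

theorem laplacian_eq_sum_fderiv {f : E3 → ℝ} (hf : ContDiff ℝ 2 f) (x : E3) :
    laplacian f x = ∑ i : Fin 3, fderiv ℝ (fun y => fderiv ℝ f y (EuclideanSpace.single i 1)) x
      (EuclideanSpace.single i 1) := by
  have h1 : DifferentiableAt ℝ (fderiv ℝ f) x :=
    (hf.fderiv_right (m := 1) (by norm_num)).differentiable (by norm_num) x
  unfold laplacian
  refine Finset.sum_congr rfl fun i _ => ?_
  rw [iteratedFDeriv_two_apply, fderiv_clm_apply h1 (differentiableAt_const _)]
  simp

theorem laplacian_congr_nhds {f g : E3 → ℝ} {x : E3} (h : f =ᶠ[nhds x] g) :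
    laplacian f x = laplacian g x := by
  simp only [laplacian, (h.iteratedFDeriv ℝ 2).eq_of_nhds]

theorem laplacian_sub_const (f : E3 → ℝ) (a : ℝ) (x : E3) :
    laplacian (fun y => f y - a) x = laplacian f x := by
  have h : fderiv ℝ (fun y => f y - a) = fderiv ℝ f := by
    funext y
    rw [fderiv_sub_const]
  simp only [laplacian, iteratedFDeriv_two_apply, h]

theorem continuous_laplacian {f : E3 → ℝ} (hf : ContDiff ℝ 2 f) : Continuous (laplacian f) := by
  unfold laplacian
  have h := hf.continuous_iteratedFDeriv (m := 2) le_rfl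
  fun_prop

/-- Translation and reflection invariance of the Laplacian. -/
theorem laplacian_comp_const_sub {f : E3 → ℝ} (hf : ContDiff ℝ 2 f) (x z : E3) :
    laplacian (fun z => f (x - z)) z = laplacian f (x - z) := by
  have h0 : ∀ z : E3, HasFDerivAt (fun z => x - z) (-ContinuousLinearMap.id ℝ E3) z := fun z =>
    (hasFDerivAt_id z).const_sub x
  have h1 : fderiv ℝ (fun z => f (x - z)) = fun z => -(fderiv ℝ f (x - z)) := by
    funext z
    have := ((hf.differentiable (by norm_num) (x - z)).hasFDerivAt.comp z (h0 z)).fderiv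
    rw [show (fun z => f (x - z)) = f ∘ fun z => x - z from rfl, this]
    ext v
    simp
  have h2 : DifferentiableAt ℝ (fderiv ℝ f) (x - z) :=
    (hf.fderiv_right (m := 1) (by norm_num)).differentiable (by norm_num) _
  have h3 := (h2.hasFDerivAt.comp z (h0 z)).neg.fderiv
  have h4 : fderiv ℝ (fun z => -(fderiv ℝ f (x - z))) z =
      -((fderiv ℝ (fderiv ℝ f) (x - z)).comp (-ContinuousLinearMap.id ℝ E3)) := h3
  simp only [laplacian, iteratedFDeriv_two_apply, h1, h4]
  simp

/-- Green's second identity when one of the functions has compact support. -/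
theorem integral_mul_laplacian {f g : E3 → ℝ} (hf : ContDiff ℝ 2 f) (hg : ContDiff ℝ 2 g)
    (hc : HasCompactSupport g) :
    ∫ x, f x * laplacian g x = ∫ x, laplacian f x * g x := by
  have key : ∀ v : E3, ∫ x, f x * fderiv ℝ (fun y => fderiv ℝ g y v) x v =
      ∫ x, fderiv ℝ (fun y => fderiv ℝ f y v) x v * g x := by
    intro v
    have hf1 : ContDiff ℝ 1 (fun y => fderiv ℝ f y v) :=
      (hf.fderiv_right (m := 1) (by norm_num)).clm_apply contDiff_const
    have hg1 : ContDiff ℝ 1 (fun y => fderiv ℝ g y v) :=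
      (hg.fderiv_right (m := 1) (by norm_num)).clm_apply contDiff_const
    have hf2 : Continuous fun y => fderiv ℝ (fun y => fderiv ℝ f y v) y v :=
      (hf1.continuous_fderiv (by norm_num)).clm_apply continuous_const
    have hg2 : Continuous fun y => fderiv ℝ (fun y => fderiv ℝ g y v) y v :=
      (hg1.continuous_fderiv (by norm_num)).clm_apply continuous_const
    have hc1 : HasCompactSupport (fun y => fderiv ℝ g y v) := hc.fderiv_apply ℝ v
    have hc2 : HasCompactSupport (fun y => fderiv ℝ (fun y => fderiv ℝ g y v) y v) :=
      hc1.fderiv_apply ℝ v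
    have I1 := integral_mul_fderiv_eq_neg_fderiv_mul_of_integrable
      (μ := MeasureTheory.volume) (f := f)
      (g := fun y => fderiv ℝ g y v) (v := v)
      (((hf1.continuous).mul hg1.continuous).integrable_of_hasCompactSupport hc1.mul_left)
      ((hf.continuous.mul hg2).integrable_of_hasCompactSupport hc2.mul_left)
      ((hf.continuous.mul hg1.continuous).integrable_of_hasCompactSupport hc1.mul_left)
      (fun x _ => hf.differentiable (by norm_num) x)
      (fun x _ => hg1.differentiable (by norm_num) x)
    have I2 := integral_mul_fderiv_eq_neg_fderiv_mul_of_integrable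
      (μ := MeasureTheory.volume)
      (f := fun y => fderiv ℝ f y v) (g := g) (v := v)
      ((hf2.mul hg.continuous).integrable_of_hasCompactSupport hc.mul_left)
      ((hf1.continuous.mul hg1.continuous).integrable_of_hasCompactSupport hc1.mul_left)
      ((hf1.continuous.mul hg.continuous).integrable_of_hasCompactSupport hc.mul_left)
      (fun x _ => hf1.differentiable (by norm_num) x)
      (fun x _ => hg.differentiable (by norm_num) x)
    rw [I1, I2, neg_neg]
  simp only [laplacian_eq_sum_fderiv hf, laplacian_eq_sum_fderiv hg, Finset.mul_sum,
    Finset.sum_mul]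
  rw [MeasureTheory.integral_finsetSum, MeasureTheory.integral_finsetSum]
  · exact Finset.sum_congr rfl fun i _ => key _
  · intro i _
    have hf1 : ContDiff ℝ 1 (fun y => fderiv ℝ f y (EuclideanSpace.single i 1)) :=
      (hf.fderiv_right (m := 1) (by norm_num)).clm_apply contDiff_const
    exact (((hf1.continuous_fderiv (by norm_num)).clm_apply continuous_const).mul
      hg.continuous).integrable_of_hasCompactSupport hc.mul_left
  · intro i _
    have hg1 : ContDiff ℝ 1 (fun y => fderiv ℝ g y (EuclideanSpace.single i 1)) :=
      (hg.fderiv_right (m := 1) (by norm_num)).clm_apply contDiff_const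
    exact (hf.continuous.mul ((hg1.continuous_fderiv (by norm_num)).clm_apply
      continuous_const)).integrable_of_hasCompactSupport
      ((hc.fderiv_apply ℝ _).fderiv_apply ℝ _).mul_left

/-- The Laplacian of a radial function on `ℝ³`, as a function of the squared radius. -/
noncomputable def radialLaplacian (G : ℝ → ℝ) (s : ℝ) : ℝ :=
  4 * s * deriv (deriv G) s + 6 * deriv G s

theorem continuous_radialLaplacian {G : ℝ → ℝ} (hG : ContDiff ℝ 2 G) :
    Continuous (radialLaplacian G) := by
  have h1 : ContDiff ℝ 1 (deriv G) := hG.iterate_deriv' 1 1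
  have h2 : Continuous (deriv (deriv G)) := h1.continuous_deriv le_rfl
  have h3 := h1.continuous
  unfold radialLaplacian
  fun_prop

theorem laplacian_radial {G : ℝ → ℝ} (hG : ContDiff ℝ 2 G) (x : E3) :
    laplacian (fun y => G (‖y‖ ^ 2)) x = radialLaplacian G (‖x‖ ^ 2) := by
  have h1 : ContDiff ℝ 1 (deriv G) := hG.iterate_deriv' 1 1
  have hn : ∀ y : E3, HasFDerivAt (fun y : E3 => ‖y‖ ^ 2) (2 • innerSL ℝ y) y := fun y =>
    (hasStrictFDerivAt_norm_sq y).hasFDerivAt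
  have hfd : fderiv ℝ (fun y : E3 => G (‖y‖ ^ 2)) =
      fun y => deriv G (‖y‖ ^ 2) • (2 • innerSL ℝ y) := by
    funext y
    exact ((hG.differentiable (by norm_num) _).hasDerivAt.comp_hasFDerivAt y (hn y)).fderiv
  have hsm : ContDiff ℝ 2 (fun y : E3 => G (‖y‖ ^ 2)) := hG.comp (contDiff_norm_sq ℝ)
  rw [laplacian_eq_sum_fderiv hsm]
  have hterm : ∀ i : Fin 3, fderiv ℝ (fun y => fderiv ℝ (fun y : E3 => G (‖y‖ ^ 2)) y
      (EuclideanSpace.single i 1)) x (EuclideanSpace.single i 1) =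
      4 * (x i) ^ 2 * deriv (deriv G) (‖x‖ ^ 2) + 2 * deriv G (‖x‖ ^ 2) := by
    intro i
    have e1 : (fun y => fderiv ℝ (fun y : E3 => G (‖y‖ ^ 2)) y (EuclideanSpace.single i 1)) =
        fun y : E3 => deriv G (‖y‖ ^ 2) * (2 * y i) := by
      funext y
      rw [hfd]
      simp [EuclideanSpace.inner_single_right]
    rw [e1]
    have d1 : HasFDerivAt (fun y : E3 => deriv G (‖y‖ ^ 2))
        (deriv (deriv G) (‖x‖ ^ 2) • (2 • innerSL ℝ x)) x :=
      (h1.differentiable (by norm_num) _).hasDerivAt.comp_hasFDerivAt x (hn x)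
    have d2 : HasFDerivAt (fun y : E3 => 2 * y i)
        ((2 : ℝ) • (EuclideanSpace.proj i : E3 →L[ℝ] ℝ)) x :=
      (EuclideanSpace.proj i : E3 →L[ℝ] ℝ).hasFDerivAt.const_mul 2
    have d3 : HasFDerivAt (fun y : E3 => deriv G (‖y‖ ^ 2) * (2 * y i)) _ x := d1.mul d2
    rw [d3.fderiv]
    simp [EuclideanSpace.inner_single_right]
    ring
  have hx := EuclideanSpace.real_norm_sq_eq x
  rw [Fin.sum_univ_three] at hx
  simp only [hterm, radialLaplacian, Fin.sum_univ_three]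
  linear_combination -4 * deriv (deriv G) (‖x‖ ^ 2) * hx

theorem radialLaplacian_comp_mul_left {G : ℝ → ℝ} (a b s : ℝ) :
    radialLaplacian (fun s => b * G (a * s)) s = b * a * radialLaplacian G (a * s) := by
  have h1 : ∀ (F : ℝ → ℝ) (b : ℝ), deriv (fun s => b * F (a * s)) =
      fun s => (b * a) * deriv F (a * s) := by
    intro F b
    funext s
    rw [deriv_const_mul_field, deriv_comp_mul_left, smul_eq_mul, mul_assoc]
  simp only [radialLaplacian, h1]
  ring

theorem radialLaplacian_sub {F G : ℝ → ℝ} (hF : ContDiff ℝ 2 F) (hG : ContDiff ℝ 2 G) (s : ℝ) :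
    radialLaplacian (fun s => F s - G s) s = radialLaplacian F s - radialLaplacian G s := by
  have hF1 : ContDiff ℝ 1 (deriv F) := hF.iterate_deriv' 1 1
  have hG1 : ContDiff ℝ 1 (deriv G) := hG.iterate_deriv' 1 1
  have h1 : deriv (fun s => F s - G s) = fun s => deriv F s - deriv G s := by
    funext s
    exact deriv_fun_sub (hF.differentiable (by norm_num) s) (hG.differentiable (by norm_num) s)
  simp only [radialLaplacian, h1]
  rw [deriv_fun_sub (hF1.differentiable (by norm_num) s) (hG1.differentiable (by norm_num) s)]
  ring

/-- A smooth function of the squared radius, vanishing near the origin, that agrees with the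
Newtonian kernel `s ↦ 1 / √s` for `1 ≤ s`. -/
noncomputable def newtonProfile (s : ℝ) : ℝ :=
  Real.smoothTransition (4 * s - 2) * s ^ (-1 / 2 : ℝ)

theorem newtonProfile_of_le {s : ℝ} (hs : s ≤ 1 / 2) : newtonProfile s = 0 := by
  rw [newtonProfile, Real.smoothTransition.zero_of_nonpos (by linarith), zero_mul]

theorem newtonProfile_of_ge {s : ℝ} (hs : 3 / 4 ≤ s) : newtonProfile s = s ^ (-1 / 2 : ℝ) := by
  rw [newtonProfile, Real.smoothTransition.one_of_one_le (by linarith), one_mul]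

theorem contDiff_newtonProfile : ContDiff ℝ 2 newtonProfile := by
  rw [contDiff_iff_contDiffAt]
  intro s
  rcases lt_or_ge s (1 / 2) with hs | hs
  · refine (contDiffAt_const (c := (0 : ℝ))).congr_of_eventuallyEq ?_
    filter_upwards [Iio_mem_nhds hs] with r hr using newtonProfile_of_le (le_of_lt hr)
  · have h1 : ContDiffAt ℝ 2 (fun s : ℝ => Real.smoothTransition (4 * s - 2)) s :=
      (Real.smoothTransition.contDiff (n := 2)).contDiffAt.comp s (by fun_prop)
    exact h1.mul (Real.contDiffAt_rpow_const_of_ne (by linarith))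

theorem deriv_newtonProfile {s : ℝ} (hs : 3 / 4 < s) :
    deriv newtonProfile s = -1 / 2 * s ^ (-3 / 2 : ℝ) := by
  have h : newtonProfile =ᶠ[nhds s] fun s => s ^ (-1 / 2 : ℝ) := by
    filter_upwards [Ioi_mem_nhds hs] with r hr using newtonProfile_of_ge (le_of_lt hr)
  rw [h.deriv_eq, (Real.hasDerivAt_rpow_const (Or.inl (by linarith))).deriv]
  norm_num

theorem deriv_deriv_newtonProfile {s : ℝ} (hs : 3 / 4 < s) :
    deriv (deriv newtonProfile) s = 3 / 4 * s ^ (-5 / 2 : ℝ) := by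
  have h : deriv newtonProfile =ᶠ[nhds s] fun s => -1 / 2 * s ^ (-3 / 2 : ℝ) := by
    filter_upwards [Ioi_mem_nhds hs] with r hr using deriv_newtonProfile hr
  rw [h.deriv_eq, ((Real.hasDerivAt_rpow_const (Or.inl (by linarith))).const_mul _).deriv]
  norm_num
  ring

theorem radialLaplacian_newtonProfile_of_ge {s : ℝ} (hs : 1 ≤ s) :
    radialLaplacian newtonProfile s = 0 := by
  rw [radialLaplacian, deriv_newtonProfile (by linarith), deriv_deriv_newtonProfile (by linarith),
    show (-3 / 2 : ℝ) = -5 / 2 + 1 by norm_num, Real.rpow_add_one (by linarith)]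
  ring

theorem hasCompactSupport_radialLaplacian_newtonProfile {E : Type*} [NormedAddCommGroup E]
    [ProperSpace E] :
    HasCompactSupport fun z : E => radialLaplacian newtonProfile (‖z‖ ^ 2) := by
  refine HasCompactSupport.intro (isCompact_closedBall 0 1) fun z hz => ?_
  have hz' : 1 < ‖z‖ := by simpa using hz
  exact radialLaplacian_newtonProfile_of_ge (by nlinarith)

theorem continuous_radialLaplacian_newtonProfile :
    Continuous (radialLaplacian newtonProfile) :=
  continuous_radialLaplacian contDiff_newtonProfile

theorem integral_radialLaplacian_newtonProfile :
    ∫ z : E3, radialLaplacian newtonProfile (‖z‖ ^ 2) =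
      -(3 * MeasureTheory.volume.real (Metric.ball (0 : E3) 1)) := by
  have h1 := MeasureTheory.integral_fun_norm_addHaar (MeasureTheory.volume : MeasureTheory.Measure E3)
    fun r => radialLaplacian newtonProfile (r ^ 2)
  have hd1 : ContDiff ℝ 1 (deriv newtonProfile) := contDiff_newtonProfile.iterate_deriv' 1 1
  have h2 : ∫ r in Set.Ioi (0 : ℝ), r ^ 2 * radialLaplacian newtonProfile (r ^ 2) = -1 - 0 := by
    have hder : ∀ r ∈ Set.Ici (0 : ℝ), HasDerivAt (fun r : ℝ => 2 * r ^ 3 * deriv newtonProfile (r ^ 2))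
        (r ^ 2 * radialLaplacian newtonProfile (r ^ 2)) r := by
      intro r _
      have a1 : HasDerivAt (fun r : ℝ => 2 * r ^ 3) (2 * (3 * r ^ 2)) r := by
        simpa using (hasDerivAt_pow 3 r).const_mul 2
      have a2 : HasDerivAt (fun r : ℝ => r ^ 2) (2 * r) r := by simpa using hasDerivAt_pow 2 r
      have a3 : HasDerivAt (fun r : ℝ => deriv newtonProfile (r ^ 2))
          (deriv (deriv newtonProfile) (r ^ 2) * (2 * r)) r :=
        HasDerivAt.comp (h₂ := deriv newtonProfile) r
          (hd1.differentiable (by norm_num) (r ^ 2)).hasDerivAt a2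
      refine (a1.fun_mul a3).congr_deriv ?_
      rw [radialLaplacian]
      ring
    have hint : MeasureTheory.IntegrableOn
        (fun r : ℝ => r ^ 2 * radialLaplacian newtonProfile (r ^ 2)) (Set.Ioi 0) := by
      have hc := continuous_radialLaplacian_newtonProfile
      refine (Continuous.integrable_of_hasCompactSupport (by fun_prop) ?_).integrableOn
      have := hasCompactSupport_radialLaplacian_newtonProfile (E := ℝ)
      simp only [Real.norm_eq_abs, sq_abs] at this
      exact this.mul_left
    have hlim : Tendsto (fun r : ℝ => 2 * r ^ 3 * deriv newtonProfile (r ^ 2)) atTop (nhds (-1)) := by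
      refine tendsto_const_nhds.congr' ?_
      filter_upwards [eventually_ge_atTop 1] with r hr
      rw [deriv_newtonProfile (by nlinarith), ← Real.rpow_natCast r 2, ← Real.rpow_mul (by linarith),
        show ((2 : ℕ) : ℝ) * (-3 / 2) = ((-3 : ℤ) : ℝ) by norm_num, Real.rpow_intCast]
      have : r ≠ 0 := by linarith
      field_simp
    rw [MeasureTheory.integral_Ioi_of_hasDerivAt_of_tendsto' hder hint hlim]
    simp
  simp only [finrank_euclideanSpace, Fintype.card_fin, smul_eq_mul, nsmul_eq_mul] at h1
  norm_num at h1 h2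
  rw [h1, h2]
  ring

/-- The Newtonian kernel `z ↦ 1 / ‖z‖` regularized at scale `t`. -/
noncomputable def newtonKernel (t : ℝ) (z : E3) : ℝ :=
  t⁻¹ * newtonProfile ((t ^ 2)⁻¹ * ‖z‖ ^ 2)

theorem newtonKernel_of_le_norm {t : ℝ} (ht : 0 < t) {z : E3} (hz : t ≤ ‖z‖) :
    newtonKernel t z = ‖z‖⁻¹ := by
  have h0 : 0 < ‖z‖ := ht.trans_le hz
  have h1 : 1 ≤ (t ^ 2)⁻¹ * ‖z‖ ^ 2 := by
    rw [← div_eq_inv_mul, one_le_div (by positivity)]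
    gcongr
  rw [newtonKernel, newtonProfile_of_ge (by linarith), ← inv_pow, ← mul_pow, ← Real.rpow_natCast,
    ← Real.rpow_mul (by positivity)]
  norm_num [Real.rpow_neg_one]
  field_simp

theorem newtonKernel_of_norm_sq_le {t : ℝ} (ht : 0 < t) {z : E3} (hz : ‖z‖ ^ 2 ≤ t ^ 2 / 2) :
    newtonKernel t z = 0 := by
  rw [newtonKernel, newtonProfile_of_le, mul_zero]
  rw [← div_eq_inv_mul, div_le_iff₀ (by positivity)]
  linarith

/-- Weighted mean of `φ` over the ball of radius `t` about `x`, with weight the Laplacian of the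
regularized Newtonian kernel. -/
noncomputable def newtonMean (φ : E3 → ℝ) (x : E3) (t : ℝ) : ℝ :=
  ∫ z : E3, radialLaplacian newtonProfile (‖z‖ ^ 2) * φ (x - t • z)

theorem newtonMean_eq {φ : E3 → ℝ} (x : E3) {t : ℝ} (ht : 0 < t) :
    newtonMean φ x t = ∫ z : E3, φ (x - z) *
      (t⁻¹ * (t ^ 2)⁻¹ * radialLaplacian newtonProfile ((t ^ 2)⁻¹ * ‖z‖ ^ 2)) := by
  have h := MeasureTheory.Measure.integral_comp_smul
    (MeasureTheory.volume : MeasureTheory.Measure E3)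
    (fun z => radialLaplacian newtonProfile ((t ^ 2)⁻¹ * ‖z‖ ^ 2) * φ (x - z)) t
  have h1 : ∀ z : E3, (t ^ 2)⁻¹ * ‖t • z‖ ^ 2 = ‖z‖ ^ 2 := by
    intro z
    rw [norm_smul, Real.norm_of_nonneg ht.le]
    field_simp
  simp only [h1] at h
  rw [newtonMean, h, abs_of_pos (by positivity), smul_eq_mul, ← MeasureTheory.integral_const_mul]
  congr 1
  funext z
  simp only [finrank_euclideanSpace, Fintype.card_fin]
  field_simp

theorem newtonMean_sub_newtonMean {φ : E3 → ℝ} (hφ : ContDiff ℝ 2 φ) (x : E3) {ε R : ℝ}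
    (hε : 0 < ε) (hR : 0 < R) :
    newtonMean φ x ε - newtonMean φ x R =
      ∫ z : E3, laplacian φ (x - z) * (newtonKernel ε z - newtonKernel R z) := by
  have hsc : ∀ t : ℝ, ContDiff ℝ 2 fun s => t⁻¹ * newtonProfile ((t ^ 2)⁻¹ * s) := fun t =>
    contDiff_const.mul (contDiff_newtonProfile.comp (contDiff_const.mul contDiff_id))
  have hG := (hsc ε).sub (hsc R)
  have hf : ContDiff ℝ 2 fun z => φ (x - z) := hφ.comp (contDiff_const.sub contDiff_id)
  have hg : ContDiff ℝ 2 fun z => newtonKernel ε z - newtonKernel R z :=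
    hG.comp (contDiff_norm_sq ℝ)
  have hsupp : HasCompactSupport fun z => newtonKernel ε z - newtonKernel R z := by
    refine HasCompactSupport.intro (isCompact_closedBall 0 (max ε R)) fun z hz => ?_
    have hz' : max ε R < ‖z‖ := by simpa using hz
    rw [newtonKernel_of_le_norm hε ((le_max_left _ _).trans hz'.le),
      newtonKernel_of_le_norm hR ((le_max_right _ _).trans hz'.le), sub_self]
  have hlap : ∀ z, laplacian (fun z => newtonKernel ε z - newtonKernel R z) z =
      ε⁻¹ * (ε ^ 2)⁻¹ * radialLaplacian newtonProfile ((ε ^ 2)⁻¹ * ‖z‖ ^ 2) -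
      R⁻¹ * (R ^ 2)⁻¹ * radialLaplacian newtonProfile ((R ^ 2)⁻¹ * ‖z‖ ^ 2) := by
    intro z
    have h := laplacian_radial hG z
    rw [radialLaplacian_sub (hsc ε) (hsc R), radialLaplacian_comp_mul_left,
      radialLaplacian_comp_mul_left] at h
    exact h
  have hint : ∀ t : ℝ, 0 < t → MeasureTheory.Integrable fun z : E3 => φ (x - z) *
      (t⁻¹ * (t ^ 2)⁻¹ * radialLaplacian newtonProfile ((t ^ 2)⁻¹ * ‖z‖ ^ 2)) := by
    intro t ht
    have hc := continuous_radialLaplacian_newtonProfile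
    have hc' := hf.continuous
    refine Continuous.integrable_of_hasCompactSupport (by fun_prop) ?_
    refine HasCompactSupport.intro (isCompact_closedBall 0 t) fun z hz => ?_
    have hz' : t < ‖z‖ := by simpa using hz
    rw [radialLaplacian_newtonProfile_of_ge, mul_zero, mul_zero]
    rw [← div_eq_inv_mul, one_le_div (by positivity)]
    gcongr
  have hgreen := integral_mul_laplacian hf hg hsupp
  simp only [hlap, mul_sub, laplacian_comp_const_sub hφ] at hgreen
  rw [newtonMean_eq x hε, newtonMean_eq x hR, ← MeasureTheory.integral_sub (hint ε hε) (hint R hR),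
    hgreen]
  simp only [mul_sub]

theorem exists_bound_of_tendsto_cocompact {E : Type*} [TopologicalSpace E] {φ : E → ℝ}
    (hφ : Continuous φ) (h0 : Tendsto φ (cocompact E) (nhds 0)) : ∃ B, ∀ x, ‖φ x‖ ≤ B := by
  have h1 : ∀ᶠ x in cocompact E, ‖φ x‖ < 1 := by
    simpa using h0.norm.eventually_lt_const (by simp : ‖(0 : ℝ)‖ < 1)
  obtain ⟨K, hK, hK'⟩ := mem_cocompact.1 h1
  obtain ⟨B, hB⟩ := hK.exists_bound_of_continuousOn hφ.continuousOn
  refine ⟨max B 1, fun x => ?_⟩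
  by_cases hx : x ∈ K
  · exact (hB x hx).trans (le_max_left _ _)
  · exact (le_of_lt (hK' hx)).trans (le_max_right _ _)

theorem tendsto_newtonMean {φ : E3 → ℝ} (hφ : Continuous φ)
    (h0 : Tendsto φ (cocompact E3) (nhds 0)) (x : E3) {l : Filter ℝ} [l.IsCountablyGenerated]
    {a : ℝ} (hl : ∀ z : E3, z ≠ 0 → Tendsto (fun t => φ (x - t • z)) l (nhds a)) :
    Tendsto (newtonMean φ x) l
      (nhds (∫ z : E3, radialLaplacian newtonProfile (‖z‖ ^ 2) * a)) := by
  obtain ⟨B, hB⟩ := exists_bound_of_tendsto_cocompact hφ h0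
  have hc := continuous_radialLaplacian_newtonProfile
  refine MeasureTheory.tendsto_integral_filter_of_dominated_convergence
    (fun z => ‖radialLaplacian newtonProfile (‖z‖ ^ 2)‖ * B) ?_ ?_ ?_ ?_
  · exact Eventually.of_forall fun t => Continuous.aestronglyMeasurable (by fun_prop)
  · refine Eventually.of_forall fun t => Eventually.of_forall fun z => ?_
    rw [norm_mul]
    gcongr
    exact hB _
  · refine MeasureTheory.Integrable.mul_const (MeasureTheory.Integrable.norm ?_) B
    exact Continuous.integrable_of_hasCompactSupport (by fun_prop)
      hasCompactSupport_radialLaplacian_newtonProfile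
  · filter_upwards [MeasureTheory.Measure.ae_ne MeasureTheory.volume (0 : E3)] with z hz
    exact (hl z hz).const_mul _

theorem tendsto_newtonMean_nhdsGT_zero {φ : E3 → ℝ} (hφ : Continuous φ)
    (h0 : Tendsto φ (cocompact E3) (nhds 0)) (x : E3) :
    Tendsto (newtonMean φ x) (nhdsWithin 0 (Set.Ioi 0))
      (nhds (-(3 * MeasureTheory.volume.real (Metric.ball (0 : E3) 1)) * φ x)) := by
  rw [← integral_radialLaplacian_newtonProfile, ← MeasureTheory.integral_mul_const]
  refine tendsto_newtonMean hφ h0 x fun z _ => ?_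
  have h : Continuous fun t : ℝ => φ (x - t • z) := by fun_prop
  simpa using (h.tendsto 0).mono_left nhdsWithin_le_nhds

theorem tendsto_newtonMean_atTop {φ : E3 → ℝ} (hφ : Continuous φ)
    (h0 : Tendsto φ (cocompact E3) (nhds 0)) (x : E3) :
    Tendsto (newtonMean φ x) atTop (nhds 0) := by
  have h := tendsto_newtonMean (l := atTop) hφ h0 x (a := 0) fun z hz => h0.comp ?_
  · simpa using h
  rw [← Metric.cobounded_eq_cocompact, ← tendsto_norm_atTop_iff_cobounded]
  refine tendsto_atTop_mono' atTop (f₁ := fun t : ℝ => t * ‖z‖ - ‖x‖) ?_ ?_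
  · filter_upwards [eventually_ge_atTop 0] with t ht
    have := norm_sub_norm_le (t • z) x
    rw [norm_smul, Real.norm_of_nonneg ht] at this
    rwa [norm_sub_rev]
  · exact tendsto_atTop_add_const_right _ _ (tendsto_id.atTop_mul_const (norm_pos_iff.2 hz))

/-- A `C²` function vanishing at infinity whose Laplacian is supported in a ball is, outside this
ball, the Newtonian potential of its Laplacian. -/
theorem eq_newtonPotential {φ : E3 → ℝ} (hφ : ContDiff ℝ 2 φ)
    (h0 : Tendsto φ (cocompact E3) (nhds 0)) {r : ℝ}
    (hr : ∀ y, r < ‖y‖ → laplacian φ y = 0) {x : E3} (hx : r < ‖x‖) :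
    3 * MeasureTheory.volume.real (Metric.ball (0 : E3) 1) * φ x =
      -∫ y, laplacian φ y * ‖x - y‖⁻¹ := by
  have hval : ∀ ε R : ℝ, 0 < ε → ε ≤ ‖x‖ - r → 2 * (‖x‖ + r) < R → 0 < R →
      newtonMean φ x ε - newtonMean φ x R = ∫ y, laplacian φ y * ‖x - y‖⁻¹ := by
    intro ε R hε hεr hRr hR
    rw [newtonMean_sub_newtonMean hφ x hε hR, ← MeasureTheory.integral_sub_left_eq_self _ _ x]
    congr 1
    funext y
    rw [sub_sub_cancel]
    by_cases hy : r < ‖y‖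
    · rw [hr y hy, zero_mul, zero_mul]
    · push Not at hy
      have h1 := norm_sub_norm_le x y
      have h2 := norm_sub_le x y
      rw [newtonKernel_of_le_norm hε (by linarith), newtonKernel_of_norm_sq_le hR, sub_zero]
      nlinarith [norm_nonneg (x - y)]
  have hlim1 : ∀ ε : ℝ, 0 < ε → ε ≤ ‖x‖ - r →
      newtonMean φ x ε = ∫ y, laplacian φ y * ‖x - y‖⁻¹ := by
    intro ε hε hεr
    have h1 : Tendsto (fun R => newtonMean φ x ε - newtonMean φ x R) atTop
        (nhds (newtonMean φ x ε - 0)) :=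
      tendsto_const_nhds.sub (tendsto_newtonMean_atTop hφ.continuous h0 x)
    rw [sub_zero] at h1
    refine tendsto_nhds_unique h1 (tendsto_const_nhds.congr' ?_)
    filter_upwards [eventually_gt_atTop 0, eventually_gt_atTop (2 * (‖x‖ + r))] with R hR hR'
    exact (hval ε R hε hεr hR' hR).symm
  have h2 := tendsto_newtonMean_nhdsGT_zero hφ.continuous h0 x
  have h3 : -(3 * MeasureTheory.volume.real (Metric.ball (0 : E3) 1)) * φ x =
      ∫ y, laplacian φ y * ‖x - y‖⁻¹ := by
    refine tendsto_nhds_unique h2 (tendsto_const_nhds.congr' ?_)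
    filter_upwards [Ioc_mem_nhdsGT (sub_pos.2 hx)] with ε hε
    exact (hlim1 ε hε.1 hε.2).symm
  linarith

/-- The differential of `d ↦ ‖d‖⁻¹` away from the origin. -/
noncomputable def newtonForce (d : E3) : E3 →L[ℝ] ℝ := -((‖d‖ ^ 3)⁻¹ • innerSL ℝ d)

theorem hasFDerivAt_norm_inv {d : E3} (hd : d ≠ 0) :
    HasFDerivAt (fun d : E3 => ‖d‖⁻¹) (newtonForce d) d := by
  have h0 : 0 < ‖d‖ := norm_pos_iff.2 hd
  have h1 : HasFDerivAt (fun d : E3 => ‖d‖ ^ 2) (2 • innerSL ℝ d) d :=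
    (hasStrictFDerivAt_norm_sq d).hasFDerivAt
  have h2 : HasDerivAt (fun s : ℝ => (√s)⁻¹) (-(1 / (2 * √(‖d‖ ^ 2))) / √(‖d‖ ^ 2) ^ 2)
      (‖d‖ ^ 2) := (Real.hasDerivAt_sqrt (by positivity)).inv (by positivity)
  have h3 := h2.comp_hasFDerivAt d h1
  rw [Real.sqrt_sq h0.le] at h3
  have h4 : ((fun s : ℝ => (√s)⁻¹) ∘ fun d : E3 => ‖d‖ ^ 2) = fun d : E3 => ‖d‖⁻¹ := by
    funext y
    simp [Real.sqrt_sq (norm_nonneg y)]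
  rw [h4] at h3
  refine h3.congr_fderiv ?_
  ext v
  simp [newtonForce]
  field_simp

theorem norm_newtonForce (d : E3) : ‖newtonForce d‖ = (‖d‖ ^ 2)⁻¹ := by
  rw [newtonForce, norm_neg, norm_smul, innerSL_apply_norm, norm_inv, norm_pow, norm_norm]
  rcases eq_or_ne ‖d‖ 0 with h | h
  · simp [h]
  · field_simp

theorem norm_newtonForce_sub_sub_le {x y : E3} (hxy : 2 * ‖y‖ ≤ ‖x‖) :
    ‖newtonForce (x - y) - newtonForce x‖ ≤ 46 * ‖y‖ * ‖x‖⁻¹ ^ 3 := by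
  rcases eq_or_ne x 0 with rfl | hx
  · have : y = 0 := by
      rw [norm_zero] at hxy
      exact norm_le_zero_iff.1 (by linarith)
    simp [this]
  have hb : 0 < ‖x‖ := norm_pos_iff.2 hx
  set b := ‖x‖ with hbdef
  set a := ‖x - y‖ with hadef
  have hab : |b - a| ≤ ‖y‖ := by
    have := abs_norm_sub_norm_le x (x - y)
    rwa [sub_sub_cancel] at this
  obtain ⟨h1, h2⟩ := abs_le.1 hab
  have ha1 : b / 2 ≤ a := by linarith
  have ha2 : a ≤ 3 * b / 2 := by linarith
  have ha : 0 < a := by linarith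
  have e : newtonForce (x - y) - newtonForce x =
      (a ^ 3)⁻¹ • innerSL ℝ y - ((a ^ 3)⁻¹ - (b ^ 3)⁻¹) • innerSL ℝ x := by
    simp only [newtonForce, ← hadef, ← hbdef, map_sub, smul_sub, sub_smul]
    abel
  have ha3 : (a ^ 3)⁻¹ ≤ 8 * b⁻¹ ^ 3 := by
    calc (a ^ 3)⁻¹ ≤ ((b / 2) ^ 3)⁻¹ := by gcongr
      _ = 8 * b⁻¹ ^ 3 := by field_simp; norm_num
  have hdiff : |(a ^ 3)⁻¹ - (b ^ 3)⁻¹| * b ≤ 38 * ‖y‖ * b⁻¹ ^ 3 := by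
    have e1 : (a ^ 3)⁻¹ - (b ^ 3)⁻¹ = (b - a) * (a ^ 2 + a * b + b ^ 2) * (a ^ 3)⁻¹ * b⁻¹ ^ 3 := by
      field_simp
      ring
    have e2 : a ^ 2 + a * b + b ^ 2 ≤ 19 / 4 * b ^ 2 := by nlinarith
    rw [e1, abs_mul, abs_mul, abs_mul, abs_of_pos (by positivity : 0 < (a ^ 3)⁻¹),
      abs_of_pos (by positivity : 0 < b⁻¹ ^ 3),
      abs_of_pos (by positivity : 0 < a ^ 2 + a * b + b ^ 2)]
    calc |b - a| * (a ^ 2 + a * b + b ^ 2) * (a ^ 3)⁻¹ * b⁻¹ ^ 3 * b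
        ≤ ‖y‖ * (19 / 4 * b ^ 2) * (8 * b⁻¹ ^ 3) * b⁻¹ ^ 3 * b := by gcongr
      _ = 38 * ‖y‖ * b⁻¹ ^ 3 := by field_simp; ring
  calc ‖newtonForce (x - y) - newtonForce x‖
      ≤ ‖(a ^ 3)⁻¹ • innerSL ℝ y‖ + ‖((a ^ 3)⁻¹ - (b ^ 3)⁻¹) • innerSL ℝ x‖ := by
        rw [e]; exact norm_sub_le _ _
    _ = (a ^ 3)⁻¹ * ‖y‖ + |(a ^ 3)⁻¹ - (b ^ 3)⁻¹| * b := by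
        rw [norm_smul, norm_smul, innerSL_apply_norm, innerSL_apply_norm, Real.norm_eq_abs,
          Real.norm_eq_abs, abs_of_pos (by positivity : 0 < (a ^ 3)⁻¹)]
    _ ≤ 8 * b⁻¹ ^ 3 * ‖y‖ + 38 * ‖y‖ * b⁻¹ ^ 3 := by gcongr
    _ = 46 * ‖y‖ * b⁻¹ ^ 3 := by ring

theorem measurable_newtonForce : Measurable newtonForce := by
  unfold newtonForce
  have h : Measurable fun d : E3 => innerSL ℝ d := (innerSL ℝ).continuous.measurable
  have h' : Measurable fun d : E3 => (‖d‖ ^ 3)⁻¹ := by fun_prop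
  exact (h'.smul h).neg

section Potential

variable {ρ : E3 → ℝ} {r : ℝ}

theorem integrable_of_continuous_of_forall_norm_gt (hρ : Continuous ρ)
    (hr : ∀ y, r < ‖y‖ → ρ y = 0) : MeasureTheory.Integrable ρ :=
  hρ.integrable_of_hasCompactSupport <| HasCompactSupport.intro (isCompact_closedBall 0 r)
    fun y hy => hr y (by simpa using hy)

theorem integrable_newtonPotential (hρ : Continuous ρ) (hr0 : 0 < r)
    (hr : ∀ y, r < ‖y‖ → ρ y = 0) {x : E3} (hx : 2 * r ≤ ‖x‖) :
    MeasureTheory.Integrable fun y => ρ y * ‖x - y‖⁻¹ := by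
  refine MeasureTheory.Integrable.mono'
    ((integrable_of_continuous_of_forall_norm_gt hρ hr).norm.mul_const r⁻¹)
    (hρ.aestronglyMeasurable.mul (by fun_prop)) (Eventually.of_forall fun y => ?_)
  by_cases hy : r < ‖y‖
  · simp [hr y hy]
  · push Not at hy
    have h1 := norm_sub_norm_le x y
    rw [norm_mul, norm_inv, norm_norm]
    gcongr
    linarith

theorem integrable_newtonForce (hρ : Continuous ρ) (hr0 : 0 < r)
    (hr : ∀ y, r < ‖y‖ → ρ y = 0) {x : E3} (hx : 2 * r ≤ ‖x‖) :
    MeasureTheory.Integrable fun y => ρ y • newtonForce (x - y) := by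
  refine MeasureTheory.Integrable.mono'
    ((integrable_of_continuous_of_forall_norm_gt hρ hr).norm.mul_const (r ^ 2)⁻¹)
    (hρ.aestronglyMeasurable.smul (measurable_newtonForce.comp
      (measurable_const.sub measurable_id)).aestronglyMeasurable) (Eventually.of_forall fun y => ?_)
  by_cases hy : r < ‖y‖
  · simp [hr y hy]
  · push Not at hy
    have h1 := norm_sub_norm_le x y
    rw [norm_smul, norm_newtonForce]
    gcongr
    linarith

theorem hasFDerivAt_newtonPotential (hρ : Continuous ρ) (hr0 : 0 < r)
    (hr : ∀ y, r < ‖y‖ → ρ y = 0) {x : E3} (hx : 2 * r < ‖x‖) :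
    HasFDerivAt (fun x => ∫ y, ρ y * ‖x - y‖⁻¹) (∫ y, ρ y • newtonForce (x - y)) x := by
  refine hasFDerivAt_integral_of_dominated_of_fderiv_le (s := {x | 2 * r < ‖x‖})
    (F := fun x y => ρ y * ‖x - y‖⁻¹) (F' := fun x y => ρ y • newtonForce (x - y))
    (bound := fun y => ‖ρ y‖ * (r ^ 2)⁻¹)
    ((isOpen_lt continuous_const continuous_norm).mem_nhds hx)
    (Eventually.of_forall fun x' => hρ.aestronglyMeasurable.mul (by fun_prop))
    (integrable_newtonPotential hρ hr0 hr hx.le)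
    (integrable_newtonForce hρ hr0 hr hx.le).aestronglyMeasurable
    (Eventually.of_forall fun y x' hx' => ?_)
    ((integrable_of_continuous_of_forall_norm_gt hρ hr).norm.mul_const _)
    (Eventually.of_forall fun y x' hx' => ?_)
  all_goals
    have hx'' : 2 * r < ‖x'‖ := hx'
    by_cases hy : r < ‖y‖
  · simp [hr y hy]
  · push Not at hy
    have h1 := norm_sub_norm_le x' y
    rw [norm_smul, norm_newtonForce]
    gcongr
    linarith
  · simpa [hr y hy] using hasFDerivAt_const (0 : ℝ) x'
  · have h1 := norm_sub_norm_le x' y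
    have h2 : x' - y ≠ 0 := norm_pos_iff.1 (by linarith)
    have h3 : HasFDerivAt (fun x : E3 => ‖x - y‖⁻¹) (newtonForce (x' - y)) x' :=
      HasFDerivAt.comp (g := fun d : E3 => ‖d‖⁻¹) (f := fun x => x - y) x'
        (hasFDerivAt_norm_inv h2) ((hasFDerivAt_id x').sub_const y)
    exact h3.const_mul (ρ y)

theorem norm_integral_newtonForce_sub_le (hρ : Continuous ρ) (hr0 : 0 < r)
    (hr : ∀ y, r < ‖y‖ → ρ y = 0) {x : E3} (hx : 2 * r ≤ ‖x‖) :
    ‖(∫ y, ρ y • newtonForce (x - y)) - (∫ y, ρ y) • newtonForce x‖ ≤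
      (∫ y, ‖ρ y‖) * (46 * r) * ‖x‖⁻¹ ^ 3 := by
  have hint := integrable_of_continuous_of_forall_norm_gt hρ hr
  have e : (∫ y, ρ y) • newtonForce x = ∫ y, ρ y • newtonForce x :=
    (integral_smul_const (𝕜 := ℝ) ρ (newtonForce x)).symm
  rw [e, ← MeasureTheory.integral_sub (integrable_newtonForce hρ hr0 hr hx)
    (hint.smul_const _), mul_assoc, ← MeasureTheory.integral_mul_const]
  refine MeasureTheory.norm_integral_le_of_norm_le (hint.norm.mul_const _)
    (Eventually.of_forall fun y => ?_)
  by_cases hy : r < ‖y‖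
  · simp [hr y hy]
  · push Not at hy
    have e' : ρ y • newtonForce (x - y) - ρ y • newtonForce x =
        ρ y • (newtonForce (x - y) - newtonForce x) := (smul_sub (ρ y) _ _).symm
    rw [e', norm_smul]
    gcongr
    refine (norm_newtonForce_sub_sub_le (by linarith)).trans ?_
    gcongr

theorem tendsto_norm_mul_newtonPotential (hρ : Continuous ρ) (hr0 : 0 < r)
    (hr : ∀ y, r < ‖y‖ → ρ y = 0) :
    Tendsto (fun x : E3 => ‖x‖ * ∫ y, ρ y * ‖x - y‖⁻¹) (cocompact E3) (nhds (∫ y, ρ y)) := by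
  have hint := integrable_of_continuous_of_forall_norm_gt hρ hr
  have hbound : ∀ x : E3, 2 * r ≤ ‖x‖ →
      ‖(‖x‖ * ∫ y, ρ y * ‖x - y‖⁻¹) - ∫ y, ρ y‖ ≤ (∫ y, ‖ρ y‖) * (2 * r) * ‖x‖⁻¹ := by
    intro x hx
    rw [← MeasureTheory.integral_const_mul, ← MeasureTheory.integral_sub
      ((integrable_newtonPotential hρ hr0 hr hx).const_mul _) hint, mul_assoc,
      ← MeasureTheory.integral_mul_const]
    refine MeasureTheory.norm_integral_le_of_norm_le (hint.norm.mul_const _)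
      (Eventually.of_forall fun y => ?_)
    by_cases hy : r < ‖y‖
    · simp [hr y hy]
    · push Not at hy
      have h1 := norm_sub_norm_le x y
      have h2 := abs_norm_sub_norm_le x (x - y)
      rw [sub_sub_cancel] at h2
      have hx0 : 0 < ‖x‖ := by linarith
      have ha0 : 0 < ‖x - y‖ := by linarith
      have e : ‖x‖ * (ρ y * ‖x - y‖⁻¹) - ρ y = ρ y * ((‖x‖ - ‖x - y‖) * ‖x - y‖⁻¹) := by
        field_simp
      have h3 : |‖x‖ - ‖x - y‖| * ‖x - y‖⁻¹ ≤ 2 * r * ‖x‖⁻¹ := by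
        calc |‖x‖ - ‖x - y‖| * ‖x - y‖⁻¹ ≤ r * (‖x‖ / 2)⁻¹ := by
              gcongr
              · linarith
              · linarith
          _ = 2 * r * ‖x‖⁻¹ := by field_simp
      rw [e, norm_mul, norm_mul, norm_inv, norm_norm, Real.norm_eq_abs (‖x‖ - ‖x - y‖)]
      gcongr
  rw [tendsto_iff_norm_sub_tendsto_zero]
  have hlarge : ∀ᶠ x : E3 in cocompact E3, 2 * r ≤ ‖x‖ :=
    (tendsto_norm_cocompact_atTop).eventually_ge_atTop _
  refine squeeze_zero' (Eventually.of_forall fun _ => norm_nonneg _)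
    (hlarge.mono fun x hx => hbound x hx) ?_
  simpa using (tendsto_inv_atTop_zero.comp (tendsto_norm_cocompact_atTop)).const_mul
    ((∫ y, ‖ρ y‖) * (2 * r))

end Potential

/-- A function harmonic outside a ball agrees, outside a larger ball, with a globally `C²`
function. -/
theorem exists_contDiff_eq_of_harmonicOn {R₀ : ℝ} (hR₀ : 0 < R₀) {u : E3 → ℝ}
    (hu : HarmonicOn u {x : E3 | R₀ < ‖x‖}) :
    ∃ φ : E3 → ℝ, ContDiff ℝ 2 φ ∧ (∀ x, 2 * R₀ < ‖x‖ → φ x = u x - 1) ∧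
      ∀ x, 2 * R₀ < ‖x‖ → laplacian φ x = 0 := by
  have heq : ∀ x : E3, 2 * R₀ < ‖x‖ →
      Real.smoothTransition ((R₀ ^ 2)⁻¹ * ‖x‖ ^ 2 - 2) * (u x - 1) = u x - 1 := by
    intro x hx
    rw [Real.smoothTransition.one_of_one_le, one_mul]
    have : 3 ≤ (R₀ ^ 2)⁻¹ * ‖x‖ ^ 2 := by
      rw [← div_eq_inv_mul, le_div_iff₀ (by positivity)]
      nlinarith
    linarith
  refine ⟨fun x => Real.smoothTransition ((R₀ ^ 2)⁻¹ * ‖x‖ ^ 2 - 2) * (u x - 1), ?_, heq, ?_⟩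
  · rw [contDiff_iff_contDiffAt]
    intro x
    rcases lt_or_ge (‖x‖ ^ 2) (2 * R₀ ^ 2) with hx | hx
    · refine (contDiffAt_const (c := (0 : ℝ))).congr_of_eventuallyEq ?_
      filter_upwards [(isOpen_lt (continuous_norm.pow 2) continuous_const).mem_nhds hx] with y hy
      have hy' : ‖y‖ ^ 2 < 2 * R₀ ^ 2 := hy
      rw [Real.smoothTransition.zero_of_nonpos, zero_mul]
      rw [sub_nonpos, ← div_eq_inv_mul, div_le_iff₀ (by positivity)]
      exact hy'.le
    · have hx' : R₀ < ‖x‖ := lt_of_pow_lt_pow_left₀ 2 (norm_nonneg x) (by nlinarith)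
      have h1 : ContDiffAt ℝ 2 u x :=
        hu.1.contDiffAt ((isOpen_lt continuous_const continuous_norm).mem_nhds hx')
      have h2 : ContDiff ℝ 2 fun x : E3 => (R₀ ^ 2)⁻¹ * ‖x‖ ^ 2 - 2 :=
        (contDiff_const.mul (contDiff_norm_sq ℝ)).sub contDiff_const
      exact (((Real.smoothTransition.contDiff (n := 2)).comp h2).contDiffAt).mul
        (h1.sub contDiffAt_const)
  · intro x hx
    have h : (fun x : E3 => Real.smoothTransition ((R₀ ^ 2)⁻¹ * ‖x‖ ^ 2 - 2) * (u x - 1))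
        =ᶠ[nhds x] fun x => u x - 1 := by
      filter_upwards [(isOpen_lt continuous_const continuous_norm).mem_nhds hx] with y hy
        using heq y hy
    rw [laplacian_congr_nhds h, laplacian_sub_const]
    exact hu.2 x (show R₀ < ‖x‖ by linarith)

/-- Gradient asymptotics for a harmonic function on an exterior region of `ℝ³` tending to `1`
at infinity: `∇u(x) = m·x/‖x‖³ + O(‖x‖⁻³)` where `m = lim ‖x‖(1 − u(x))`. -/
theorem harmonic_exterior_gradient_asymptotics
    (R₀ : ℝ) (hR₀ : 0 < R₀) (u : E3 → ℝ)
    (hu : HarmonicOn u {x : E3 | R₀ < ‖x‖})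
    (hlim : Tendsto u (Filter.cocompact E3) (nhds 1))
    (m : ℝ)
    (hm : Tendsto (fun x : E3 => ‖x‖ * (1 - u x)) (Filter.cocompact E3) (nhds m)) :
    ∃ (C R₁ : ℝ), 0 ≤ C ∧ R₀ < R₁ ∧
      ∀ x : E3, R₁ ≤ ‖x‖ →
        ‖gradient u x - (m / ‖x‖ ^ 3) • x‖ ≤ C * ‖x‖⁻¹ ^ 3 := by
  obtain ⟨φ, hφ, hφu, hφ0⟩ := exists_contDiff_eq_of_harmonicOn hR₀ hu
  have hlarge : ∀ᶠ x : E3 in cocompact E3, 2 * R₀ < ‖x‖ :=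
    (tendsto_norm_cocompact_atTop).eventually_gt_atTop _
  have hφlim : Tendsto φ (cocompact E3) (nhds 0) := by
    have h : Tendsto (fun x => u x - 1) (cocompact E3) (nhds 0) := by
      simpa using hlim.sub_const 1
    exact h.congr' (hlarge.mono fun x hx => (hφu x hx).symm)
  have hr0 : 0 < 2 * R₀ := by linarith
  have hρ := continuous_laplacian hφ
  set c : ℝ := 3 * MeasureTheory.volume.real (Metric.ball (0 : E3) 1) with hc
  have hc0 : 0 < c := mul_pos three_pos
    (ENNReal.toReal_pos (Metric.measure_ball_pos _ _ one_pos).ne' (by finiteness))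
  have hu_eq : ∀ x : E3, 2 * R₀ < ‖x‖ → u x = 1 - c⁻¹ * ∫ y, laplacian φ y * ‖x - y‖⁻¹ := by
    intro x hx
    have h := eq_newtonPotential hφ hφlim hφ0 hx
    rw [← hc, hφu x hx] at h
    rw [← eq_inv_mul_iff_mul_eq₀ hc0.ne'] at h
    linarith
  have hm_eq : m = c⁻¹ * ∫ y, laplacian φ y := by
    refine tendsto_nhds_unique hm
      (((tendsto_norm_mul_newtonPotential hρ hr0 hφ0).const_mul c⁻¹).congr' ?_)
    filter_upwards [hlarge] with x hx
    rw [hu_eq x hx]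
    ring
  refine ⟨c⁻¹ * ((∫ y, ‖laplacian φ y‖) * (46 * (2 * R₀))), 4 * R₀ + 1, by positivity,
    by linarith, fun x hx => ?_⟩
  have hfd : HasFDerivAt u (-(c⁻¹ • ∫ y, laplacian φ y • newtonForce (x - y))) x := by
    refine HasFDerivAt.congr_of_eventuallyEq (((hasFDerivAt_newtonPotential hρ hr0 hφ0
      (by linarith)).const_mul c⁻¹).const_sub 1) ?_
    have hx' : 2 * R₀ < ‖x‖ := by linarith
    filter_upwards [(isOpen_lt continuous_const continuous_norm).mem_nhds hx'] with y hy
      using hu_eq y hy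
  have hdual : InnerProductSpace.toDual ℝ E3 (gradient u x - (m / ‖x‖ ^ 3) • x) =
      -(c⁻¹ • ((∫ y, laplacian φ y • newtonForce (x - y)) -
        (∫ y, laplacian φ y) • newtonForce x)) := by
    have h1 : InnerProductSpace.toDual ℝ E3 (gradient u x) = fderiv ℝ u x := by
      simp [gradient]
    have h2 : InnerProductSpace.toDual ℝ E3 ((m / ‖x‖ ^ 3) • x) = -(m • newtonForce x) := by
      ext v
      simp [newtonForce]
      ring
    rw [map_sub, h1, h2, hfd.fderiv, hm_eq]
    module
  rw [← (InnerProductSpace.toDual ℝ E3).norm_map, hdual, norm_neg, norm_smul,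
    Real.norm_of_nonneg (by positivity : 0 ≤ c⁻¹), mul_assoc c⁻¹]
  gcongr
  exact norm_integral_newtonForce_sub_le hρ hr0 hφ0 (by linarith)
end

section
/- Let R₀ > 0 and let u be harmonic on {x ∈ ℝ³ : ‖x‖ > R₀} with u(x) → 1 as ‖x‖ → ∞, and let m = lim_{‖x‖→∞} ‖x‖(1 − u(x)) (which exists). Let σ denote the canonical surface measure on the unit sphere S² ⊆ ℝ³ (with total mass 4π). Then for every R > R₀, the outward flux of ∇u through the sphere of radius R equals 4πm; that is, ∫_{ω ∈ S²} R² ⟨∇u(R·ω), ω⟩ dσ(ω) = 4πm. -/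
open Filter MeasureTheory Real RealInnerProductSpace

theorem integral_eq_integral_Ioi_integral_toSphere {E : Type*} [NormedAddCommGroup E]
    [NormedSpace ℝ E] [Nontrivial E] [FiniteDimensional ℝ E] [MeasurableSpace E] [BorelSpace E]
    (μ : Measure E) [μ.IsAddHaarMeasure] {f : E → ℝ} (hf : Integrable f μ) :
    ∫ x, f x ∂μ = ∫ r in Set.Ioi (0 : ℝ), r ^ (Module.finrank ℝ E - 1) *
      ∫ ω : Metric.sphere (0 : E) 1, f (r • (ω : E)) ∂μ.toSphere := by
  have hmp := μ.measurePreserving_homeomorphUnitSphereProd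
  have hemb := (homeomorphUnitSphereProd E).measurableEmbedding
  let g : Metric.sphere (0 : E) 1 × Set.Ioi (0 : ℝ) → ℝ := fun p => f (p.2.1 • (p.1 : E))
  have hg : ∀ x : ({0}ᶜ : Set E), g (homeomorphUnitSphereProd E x) = f x := by
    intro x
    have h := congrArg Subtype.val ((homeomorphUnitSphereProd E).symm_apply_apply x)
    rw [homeomorphUnitSphereProd_symm_apply_coe] at h
    exact congrArg f h
  have hint : Integrable g (μ.toSphere.prod (.volumeIoiPow (Module.finrank ℝ E - 1))) := by
    rw [← hmp.integrable_comp_emb hemb]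
    have : g ∘ homeomorphUnitSphereProd E = f ∘ ((↑) : ({0}ᶜ : Set E) → E) := funext hg
    rw [this, ← integrableOn_iff_comap_subtypeVal (measurableSet_singleton _).compl]
    exact hf.integrableOn
  calc
    ∫ x, f x ∂μ = ∫ x : ({0}ᶜ : Set E), f x ∂(μ.comap (↑)) := by
      rw [integral_subtype_comap (measurableSet_singleton _).compl f, restrict_compl_singleton]
    _ = ∫ p, g p ∂μ.toSphere.prod (.volumeIoiPow (Module.finrank ℝ E - 1)) := by
      rw [← hmp.integral_comp hemb g]
      exact integral_congr_ae (.of_forall fun x => (hg x).symm)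
    _ = ∫ r, ∫ ω, g (ω, r) ∂μ.toSphere ∂.volumeIoiPow (Module.finrank ℝ E - 1) :=
      integral_prod_symm g hint
    _ = _ := by
      simp only [Measure.volumeIoiPow, ENNReal.ofReal, g]
      rw [integral_withDensity_eq_integral_smul,
        integral_subtype_comap measurableSet_Ioi fun a : ℝ ↦
          Real.toNNReal (a ^ (Module.finrank ℝ E - 1)) •
            ∫ ω : Metric.sphere (0 : E) 1, f (a • (ω : E)) ∂μ.toSphere,
        setIntegral_congr_fun measurableSet_Ioi fun x hx ↦ ?_]
      · rw [NNReal.smul_def, Real.coe_toNNReal _ (pow_nonneg hx.out.le _), smul_eq_mul]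
      · exact (measurable_subtype_coe.pow_const _).real_toNNReal

theorem exists_antideriv_of_integral_eq_zero {g : ℝ → ℝ} (hg : Continuous g)
    (hcs : HasCompactSupport g) {a : ℝ} (hsupp : tsupport g ⊆ Set.Ioi a) (h0 : ∫ x, g x = 0) :
    ∃ φ : ℝ → ℝ, ContDiff ℝ 1 φ ∧ HasCompactSupport φ ∧ tsupport φ ⊆ Set.Ioi a ∧
      deriv φ = g := by
  have hK : IsCompact (insert (a + 1) (tsupport g)) := hcs.isCompact.insert _
  obtain ⟨p, hpK, hp⟩ := hK.exists_isLeast (Set.insert_nonempty _ _)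
  obtain ⟨q, hqK, hq⟩ := hK.exists_isGreatest (Set.insert_nonempty _ _)
  have hap : a < p := by
    rcases hpK with rfl | h
    · linarith
    · exact hsupp h
  have hgz : ∀ x, x ∉ Set.Icc p q → g x = 0 := fun x hx =>
    image_eq_zero_of_notMem_tsupport fun h =>
      hx ⟨hp (Set.mem_insert_of_mem _ h), hq (Set.mem_insert_of_mem _ h)⟩
  have hderiv : ∀ x, HasDerivAt (fun r => ∫ t in a..r, g t) (g x) x := fun x =>
    hg.integral_hasStrictDerivAt a x |>.hasDerivAt
  have hderiv' := funext fun x => (hderiv x).deriv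
  have hleft : ∀ r < p, ∫ t in a..r, g t = 0 := fun r hr => by
    refine intervalIntegral.integral_zero_ae (.of_forall fun t ht => hgz t fun h => ?_)
    rw [Set.mem_uIoc] at ht
    rcases ht with ht | ht <;> linarith [h.1, ht.2]
  have hright : ∀ r, q < r → ∫ t in a..r, g t = 0 := fun r hr => by
    have hpq : p ≤ q := hp hqK
    rw [intervalIntegral.integral_of_le (by linarith),
      setIntegral_eq_integral_of_forall_compl_eq_zero, h0]
    intro t ht
    refine hgz t fun h => ht ⟨by linarith [h.1], by linarith [h.2]⟩
  have hts : tsupport (fun r => ∫ t in a..r, g t) ⊆ Set.Icc p q := by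
    refine closure_minimal (fun r hr => ?_) isClosed_Icc
    by_contra hn
    refine hr ?_
    rcases lt_or_ge r p with h | h
    · exact hleft r h
    · exact hright r (not_le.1 fun h' => hn ⟨h, h'⟩)
  refine ⟨_, ?_, ?_, fun x hx => hap.trans_le (hts hx).1, hderiv'⟩
  · rw [contDiff_one_iff_deriv, hderiv']
    exact ⟨fun x => (hderiv x).differentiableAt, hg⟩
  · exact isCompact_Icc.of_isClosed_subset (isClosed_tsupport _) hts

theorem exists_const_of_integral_deriv_mul_eq_zero {F : ℝ → ℝ} {a : ℝ}
    (hF : ContinuousOn F (Set.Ioi a))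
    (h : ∀ φ : ℝ → ℝ, ContDiff ℝ 1 φ → HasCompactSupport φ → tsupport φ ⊆ Set.Ioi a →
      ∫ r, deriv φ r * F r = 0) :
    ∃ c, ∀ r ∈ Set.Ioi a, F r = c := by
  let b : ContDiffBump (a + 2) := ⟨1 / 2, 1, by norm_num, by norm_num⟩
  have hb : tsupport (b.normed volume) ⊆ Set.Ioi a := by
    rw [b.tsupport_normed_eq, Real.closedBall_eq_Icc]
    intro x hx
    have : a + 2 - 1 ≤ x := hx.1
    simp only [Set.mem_Ioi]
    linarith
  have hmul : ∀ g : ℝ → ℝ, Continuous g → HasCompactSupport g → tsupport g ⊆ Set.Ioi a →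
      Integrable (fun r => g r * F r) := fun g hg hcs hs =>
    Continuous.integrable_of_hasCompactSupport (continuous_iff_continuousAt.2 fun x => by
      by_cases hx : x ∈ Set.Ioi a
      · exact hg.continuousAt.mul (hF.continuousAt (Ioi_mem_nhds hx))
      · have := notMem_tsupport_iff_eventuallyEq.1 (fun h => hx (hs h))
        exact (continuousAt_const (y := (0 : ℝ))).congr (this.mono fun y hy => by simp [hy]))
      hcs.mul_right
  refine ⟨∫ r, b.normed volume r * F r, ?_⟩
  set c := ∫ r, b.normed volume r * F r with hc
  have key := isOpen_Ioi.ae_eq_zero_of_integral_contDiff_smul_eq_zero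
    (f := fun r => F r - c) (U := Set.Ioi a) (μ := volume)
    ((hF.sub continuousOn_const).locallyIntegrableOn measurableSet_Ioi) fun g hg hcs hs => by
      set J := ∫ x, g x with hJ
      have hbc : Continuous (b.normed volume) := (b.contDiff_normed (n := 0)).continuous
      have hgi := hg.continuous.integrable_of_hasCompactSupport hcs (μ := volume)
      have hJb : HasCompactSupport fun x => J * b.normed volume x :=
        b.hasCompactSupport_normed.mul_left
      obtain ⟨φ, h1, h2, h3, h4⟩ := exists_antideriv_of_integral_eq_zero
        (g := fun x => g x - J * b.normed volume x) (hg.continuous.sub (continuous_const.mul hbc))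
        (hcs.sub hJb) (a := a) ((tsupport_sub _ _).trans (Set.union_subset hs
          ((tsupport_mul_subset_right).trans hb))) (by
            rw [integral_sub hgi (b.integrable_normed.const_mul J), integral_const_mul,
              b.integral_normed]
            simp [hJ])
      have h5 := h φ h1 h2 h3
      rw [h4] at h5
      have e1 : ∀ r, (g r - J * b.normed volume r) * F r
        = g r * F r - J * (b.normed volume r * F r) := fun r => by ring
      have i1 := hmul g hg.continuous hcs hs
      have i2 := hmul _ hbc b.hasCompactSupport_normed hb
      simp only [e1] at h5
      rw [integral_sub i1 (i2.const_mul J), integral_const_mul, ← hc] at h5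
      simp only [smul_eq_mul, mul_sub]
      rw [integral_sub i1 (hgi.mul_const c), integral_mul_const]
      exact h5
  have := Measure.eqOn_open_of_ae_eq (f := fun r => F r - c) (g := 0)
    ((ae_restrict_iff' measurableSet_Ioi).2 key) isOpen_Ioi (hF.sub continuousOn_const)
    continuousOn_const
  exact fun r hr => sub_eq_zero.1 (this hr)

theorem integral_fderiv_apply_eq_zero {E : Type*} [NormedAddCommGroup E] [NormedSpace ℝ E]
    [FiniteDimensional ℝ E] [MeasurableSpace E] [BorelSpace E] (μ : Measure E)
    [μ.IsAddHaarMeasure] {f : E → ℝ} (hf : ContDiff ℝ 1 f) (hcs : HasCompactSupport f) (v : E) :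
    ∫ x, fderiv ℝ f x v ∂μ = 0 := by
  have h := integral_mul_fderiv_eq_neg_fderiv_mul_of_integrable (μ := μ) (f := fun _ : E => (1 : ℝ))
    (g := f) (v := v) (by simp)
    (by simpa using ((hf.continuous_fderiv one_ne_zero).clm_apply
      continuous_const).integrable_of_hasCompactSupport (hcs.fderiv_apply ℝ v))
    (by simpa using hf.continuous.integrable_of_hasCompactSupport hcs)
    (fun _ _ => differentiableAt_const _) fun x _ => hf.differentiable one_ne_zero x
  simpa using h

theorem laplacian_eq_sum_fderiv_fderiv (u : E3 → ℝ) (x : E3) :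
    laplacian u x = ∑ i : Fin 3,
      fderiv ℝ (fderiv ℝ u) x (EuclideanSpace.single i 1) (EuclideanSpace.single i 1) := by
  simp [laplacian, iteratedFDeriv_two_apply]

theorem HarmonicOn.contDiffAt {u : E3 → ℝ} {R₀ : ℝ} (hu : HarmonicOn u {x : E3 | R₀ < ‖x‖})
    {x : E3} (hx : R₀ < ‖x‖) : ContDiffAt ℝ 2 u x :=
  hu.1.contDiffAt ((isOpen_lt continuous_const continuous_norm).mem_nhds hx)

theorem HarmonicOn.contDiffAt_fderiv {u : E3 → ℝ} {R₀ : ℝ}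
    (hu : HarmonicOn u {x : E3 | R₀ < ‖x‖}) {x : E3} (hx : R₀ < ‖x‖) :
    ContDiffAt ℝ 1 (fderiv ℝ u) x :=
  (hu.contDiffAt hx).fderiv_right (by norm_num)

/-- The divergence of `φ(‖x‖) ∇u` integrates to zero. -/
theorem HarmonicOn.integral_deriv_mul_fderiv_eq_zero {u : E3 → ℝ} {R₀ : ℝ} (hR₀ : 0 ≤ R₀)
    (hu : HarmonicOn u {x : E3 | R₀ < ‖x‖}) {φ : ℝ → ℝ} (hφ : ContDiff ℝ 1 φ)
    (hcs : HasCompactSupport φ) (hsupp : tsupport φ ⊆ Set.Ioi R₀) :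
    Integrable (fun x : E3 => deriv φ ‖x‖ * fderiv ℝ u x (‖x‖⁻¹ • x)) ∧
      ∫ x : E3, deriv φ ‖x‖ * fderiv ℝ u x (‖x‖⁻¹ • x) = 0 := by
  let e : Fin 3 → E3 := fun i => EuclideanSpace.single i 1
  let W : Fin 3 → E3 → ℝ := fun i x => φ ‖x‖ * fderiv ℝ u x (e i)
  have hzero : ∀ x : E3, ¬ R₀ < ‖x‖ → ∀ᶠ y : E3 in nhds x, φ ‖y‖ = 0 := fun x hx =>
    continuous_norm.continuousAt.eventually
      (notMem_tsupport_iff_eventuallyEq.1 fun h => hx (hsupp h))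
  have hWc : ∀ i, ContDiff ℝ 1 (W i) := fun i => contDiff_iff_contDiffAt.2 fun x => by
    by_cases hx : R₀ < ‖x‖
    · have hx0 : x ≠ 0 := norm_pos_iff.1 (hR₀.trans_lt hx)
      exact (hφ.contDiffAt.comp x (contDiffAt_norm ℝ hx0)).mul
        ((hu.contDiffAt_fderiv hx).clm_apply contDiffAt_const)
    · exact (contDiffAt_const (c := (0 : ℝ))).congr_of_eventuallyEq
        ((hzero x hx).mono fun y hy => by simp [W, hy])
  have hWs : ∀ i, HasCompactSupport (W i) := fun i => by
    obtain ⟨b, hb⟩ := hcs.isCompact.isBounded.subset_closedBall 0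
    refine HasCompactSupport.intro (isCompact_closedBall (0 : E3) b) fun x hx => ?_
    have : φ ‖x‖ = 0 := image_eq_zero_of_notMem_tsupport fun h => hx (by simpa using hb h)
    simp [W, this]
  have hdiv : ∀ x, ∑ i, fderiv ℝ (W i) x (e i) = deriv φ ‖x‖ * fderiv ℝ u x (‖x‖⁻¹ • x) := by
    intro x
    by_cases hx : R₀ < ‖x‖
    · have hx0 : x ≠ 0 := norm_pos_iff.1 (hR₀.trans_lt hx)
      have hn : HasFDerivAt (fun y : E3 => ‖y‖) (‖x‖⁻¹ • innerSL ℝ x) x := by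
        have h := (hasStrictFDerivAt_norm_sq x).hasFDerivAt.sqrt (by positivity)
        simp only [Real.sqrt_sq (norm_nonneg _)] at h
        refine h.congr_fderiv ?_
        ext v
        simp
        field_simp
      have h1 := (hφ.differentiable one_ne_zero ‖x‖).hasDerivAt.comp_hasFDerivAt x hn
      have hW : ∀ i, fderiv ℝ (W i) x (e i) =
          φ ‖x‖ * fderiv ℝ (fderiv ℝ u) x (e i) (e i)
            + deriv φ ‖x‖ * (‖x‖⁻¹ * (x i * fderiv ℝ u x (e i))) := fun i => by
        have h2 := ((hu.contDiffAt_fderiv hx).differentiableAt one_ne_zero).hasFDerivAt.clm_apply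
          (hasFDerivAt_const (e i) x)
        have h3 : HasFDerivAt (W i) _ x := h1.mul h2
        rw [h3.fderiv]
        simp [e, EuclideanSpace.inner_single_right]
        ring
      have hxs : x = ∑ i, x i • e i := by
        have := (EuclideanSpace.basisFun (Fin 3) ℝ).sum_repr x
        simpa [e] using this.symm
      have hux : fderiv ℝ u x x = ∑ i, x i * fderiv ℝ u x (e i) := by
        calc fderiv ℝ u x x = fderiv ℝ u x (∑ i, x i • e i) := by rw [← hxs]
          _ = _ := by simp
      simp only [hW]
      rw [Finset.sum_add_distrib, ← Finset.mul_sum, ← Finset.mul_sum, ← Finset.mul_sum, ← hux,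
        ← laplacian_eq_sum_fderiv_fderiv, hu.2 x hx]
      simp
    · have h0 : deriv φ ‖x‖ = 0 := by
        have : φ =ᶠ[nhds ‖x‖] fun _ => 0 :=
          notMem_tsupport_iff_eventuallyEq.1 fun h => hx (hsupp h)
        rw [this.deriv_eq, deriv_const]
      have hW : ∀ i, fderiv ℝ (W i) x = 0 := fun i => by
        have : W i =ᶠ[nhds x] fun _ => 0 := (hzero x hx).mono fun y hy => by simp [W, hy]
        rw [this.fderiv_eq, fderiv_const_apply]
      simp [hW, h0]
  have hint : ∀ i, Integrable fun x => fderiv ℝ (W i) x (e i) := fun i =>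
    (((hWc i).continuous_fderiv one_ne_zero).clm_apply
      continuous_const).integrable_of_hasCompactSupport ((hWs i).fderiv_apply ℝ (e i))
  simp only [← hdiv]
  refine ⟨integrable_finsetSum _ fun i _ => hint i, ?_⟩
  rw [integral_finsetSum _ fun i _ => hint i]
  exact Finset.sum_eq_zero fun i _ => integral_fderiv_apply_eq_zero volume (hWc i) (hWs i) (e i)

theorem norm_smul_sphere {r : ℝ} (hr : 0 ≤ r) (ω : Metric.sphere (0 : E3) 1) :
    ‖r • (ω : E3)‖ = r := by
  simp [norm_smul, abs_of_nonneg hr]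

theorem HarmonicOn.continuousOn_radialDeriv {u : E3 → ℝ} {R₀ : ℝ} (hR₀ : 0 ≤ R₀)
    (hu : HarmonicOn u {x : E3 | R₀ < ‖x‖}) :
    ContinuousOn (fun p : ℝ × Metric.sphere (0 : E3) 1 => fderiv ℝ u (p.1 • (p.2 : E3)) p.2)
      (Set.Ioi R₀ ×ˢ Set.univ) := by
  rintro ⟨r, ω⟩ ⟨hr, -⟩
  have hr' : R₀ < ‖r • (ω : E3)‖ := by rwa [norm_smul_sphere (hR₀.trans hr.le)]
  have hc : ContinuousAt (fun p : ℝ × Metric.sphere (0 : E3) 1 => p.1 • (p.2 : E3)) (r, ω) := by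
    fun_prop
  refine ContinuousAt.continuousWithinAt (ContinuousAt.clm_apply ?_ (by fun_prop))
  exact ContinuousAt.comp (g := fderiv ℝ u) (f := fun p : ℝ × Metric.sphere (0 : E3) 1 =>
    p.1 • (p.2 : E3)) (hu.contDiffAt_fderiv hr').continuousAt hc

theorem HarmonicOn.continuous_comp_smul {u : E3 → ℝ} {R₀ : ℝ} (hR₀ : 0 ≤ R₀)
    (hu : HarmonicOn u {x : E3 | R₀ < ‖x‖}) {r : ℝ} (hr : R₀ < r) :
    Continuous fun ω : Metric.sphere (0 : E3) 1 => u (r • (ω : E3)) :=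
  continuous_iff_continuousAt.2 fun ω => by
    have hr' : R₀ < ‖r • (ω : E3)‖ := by rwa [norm_smul_sphere (hR₀.trans hr.le)]
    exact ContinuousAt.comp (g := u) (f := fun ω : Metric.sphere (0 : E3) 1 => r • (ω : E3))
      (hu.contDiffAt hr').continuousAt (by fun_prop)

theorem HarmonicOn.hasDerivAt_integral_sphere {u : E3 → ℝ} {R₀ : ℝ} (hR₀ : 0 ≤ R₀)
    (hu : HarmonicOn u {x : E3 | R₀ < ‖x‖}) {r : ℝ} (hr : R₀ < r) :
    HasDerivAt
      (fun r => ∫ ω : Metric.sphere (0 : E3) 1, u (r • (ω : E3)) ∂(volume : Measure E3).toSphere)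
      (∫ ω : Metric.sphere (0 : E3) 1,
        fderiv ℝ u (r • (ω : E3)) ω ∂(volume : Measure E3).toSphere) r := by
  have hG := hu.continuousOn_radialDeriv hR₀
  have hsub : Set.Icc ((R₀ + r) / 2) (r + 1) ⊆ Set.Ioi R₀ := fun t ht => by
    have := ht.1
    simp only [Set.mem_Ioi]
    linarith
  obtain ⟨C, hC⟩ := (isCompact_Icc.prod isCompact_univ).exists_bound_of_continuousOn
    (hG.mono (Set.prod_mono hsub subset_rfl))
  refine (hasDerivAt_integral_of_dominated_loc_of_deriv_le (bound := fun _ => C)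
    (F := fun r (ω : Metric.sphere (0 : E3) 1) => u (r • (ω : E3)))
    (F' := fun r (ω : Metric.sphere (0 : E3) 1) => fderiv ℝ u (r • (ω : E3)) ω)
    (Icc_mem_nhds (by linarith) (by linarith) : Set.Icc ((R₀ + r) / 2) (r + 1) ∈ nhds r)
    ?_ ?_ ?_ ?_ (integrable_const C) ?_).2
  · filter_upwards [Ioi_mem_nhds hr] with t ht
    exact (hu.continuous_comp_smul hR₀ ht).aestronglyMeasurable
  · exact (hu.continuous_comp_smul hR₀ hr).integrable_of_hasCompactSupport
      (HasCompactSupport.of_compactSpace _)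
  · exact (hG.comp_continuous (f := fun ω => (r, ω)) (by fun_prop)
      fun ω => ⟨hr, trivial⟩).aestronglyMeasurable
  · exact .of_forall fun ω t ht => hC (t, ω) ⟨ht, trivial⟩
  · refine .of_forall fun ω t ht => ?_
    have ht' : R₀ < ‖t • (ω : E3)‖ := by
      rw [norm_smul_sphere (hR₀.trans (hsub ht).le)]
      exact hsub ht
    have h1 := ((hu.contDiffAt ht').differentiableAt two_ne_zero).hasFDerivAt
    have h2 : HasDerivAt (fun s : ℝ => s • (ω : E3)) (ω : E3) t := by
      simpa using (hasDerivAt_id t).smul_const (ω : E3)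
    exact h1.comp_hasDerivAt t h2

/-- The flux of `∇u` through the sphere of radius `r` does not depend on `r`. -/
theorem HarmonicOn.exists_flux_eq {u : E3 → ℝ} {R₀ : ℝ} (hR₀ : 0 ≤ R₀)
    (hu : HarmonicOn u {x : E3 | R₀ < ‖x‖}) :
    ∃ c, ∀ r ∈ Set.Ioi R₀, r ^ 2 * ∫ ω : Metric.sphere (0 : E3) 1,
      fderiv ℝ u (r • (ω : E3)) ω ∂(volume : Measure E3).toSphere = c := by
  refine exists_const_of_integral_deriv_mul_eq_zero ?_ fun φ hφ hcs hsupp => ?_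
  · refine (continuousOn_pow 2).mul ?_
    rw [continuousOn_iff_continuous_domRestrict]
    have := isOpen_Ioi.locallyCompactSpace (X := ℝ) (s := Set.Ioi R₀)
    have h := continuous_parametric_integral_of_continuous (μ := (volume : Measure E3).toSphere)
      (f := fun (r : Set.Ioi R₀) (ω : Metric.sphere (0 : E3) 1) =>
        fderiv ℝ u ((r : ℝ) • (ω : E3)) ω)
      ((hu.continuousOn_radialDeriv hR₀).comp_continuous
        (f := fun p : Set.Ioi R₀ × Metric.sphere (0 : E3) 1 => ((p.1 : ℝ), p.2)) (by fun_prop)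
        fun p => ⟨p.1.2, trivial⟩) isCompact_univ
    simp only [Measure.restrict_univ] at h
    exact h
  · obtain ⟨hint, h0⟩ := hu.integral_deriv_mul_fderiv_eq_zero hR₀ hφ hcs hsupp
    rw [integral_eq_integral_Ioi_integral_toSphere volume hint, finrank_euclideanSpace_fin] at h0
    rw [← setIntegral_eq_integral_of_forall_compl_eq_zero (s := Set.Ioi (0 : ℝ))]
    · refine (setIntegral_congr_fun measurableSet_Ioi fun r hr => ?_).trans h0
      have hr : 0 < r := hr
      simp only [norm_smul_sphere hr.le, smul_smul, inv_mul_cancel₀ hr.ne', one_smul,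
        integral_const_mul]
      ring
    · intro r hr
      have : φ =ᶠ[nhds r] fun _ => 0 :=
        notMem_tsupport_iff_eventuallyEq.1 fun h => hr (hR₀.trans_lt (hsupp h))
      rw [this.deriv_eq, deriv_const, zero_mul]

theorem toSphere_real_univ_E3 : (volume : Measure E3).toSphere.real Set.univ = 4 * π := by
  rw [Measure.toSphere_real_apply_univ, finrank_euclideanSpace_fin, measureReal_def,
    EuclideanSpace.volume_ball_fin_three]
  rw [ENNReal.ofReal_one, one_pow, one_mul, ENNReal.toReal_ofReal (by positivity)]
  push_cast
  ring

theorem tendsto_integral_sphere_of_tendsto_cocompact {f : E3 → ℝ} {m : ℝ}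
    (hf : Tendsto f (cocompact E3) (nhds m))
    (hmeas : ∀ᶠ r : ℝ in atTop, AEStronglyMeasurable
      (fun ω : Metric.sphere (0 : E3) 1 => f (r • (ω : E3))) (volume : Measure E3).toSphere) :
    Tendsto (fun r : ℝ => ∫ ω : Metric.sphere (0 : E3) 1,
      f (r • (ω : E3)) ∂(volume : Measure E3).toSphere) atTop (nhds (4 * π * m)) := by
  have hsm : ∀ ω : Metric.sphere (0 : E3) 1,
      Tendsto (fun r : ℝ => r • (ω : E3)) atTop (cocompact E3) := fun ω => by
    rw [← Metric.cobounded_eq_cocompact, ← comap_norm_atTop, tendsto_comap_iff]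
    refine tendsto_id.congr' ?_
    filter_upwards [eventually_ge_atTop 0] with r hr
    exact (norm_smul_sphere hr ω).symm
  have hb : ∀ᶠ x in cocompact E3, ‖f x‖ ≤ ‖m‖ + 1 :=
    hf.norm.eventually_le_const (lt_add_one _)
  rw [← Metric.cobounded_eq_cocompact, ← comap_norm_atTop, eventually_comap] at hb
  have h := tendsto_integral_filter_of_dominated_convergence
    (μ := (volume : Measure E3).toSphere) (f := fun _ => m) (fun _ => ‖m‖ + 1) hmeas
    (by
      filter_upwards [hb, eventually_ge_atTop 0] with r hr hr0
      exact .of_forall fun ω => hr _ (norm_smul_sphere hr0 ω))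
    (integrable_const _) (.of_forall fun ω => hf.comp (hsm ω))
  rwa [integral_const, toSphere_real_univ_E3, smul_eq_mul] at h

/-- Flux identity: for a harmonic function `u` on an exterior region of `ℝ³` with `u → 1` at
infinity and `m = lim ‖x‖(1 − u(x))`, the outward flux of `∇u` through every sphere of radius
`R > R₀` equals `4πm`.  Here the flux is written as an integral over the unit sphere `S²` with
its canonical surface measure (of total mass `4π`). -/
theorem flux_of_harmonic_exterior_eq_four_pi_mass
    (R₀ : ℝ) (hR₀ : 0 < R₀) (u : E3 → ℝ)
    (hu : HarmonicOn u {x : E3 | R₀ < ‖x‖})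
    (hlim : Tendsto u (Filter.cocompact E3) (nhds 1))
    (m : ℝ)
    (hm : Tendsto (fun x : E3 => ‖x‖ * (1 - u x)) (Filter.cocompact E3) (nhds m)) :
    ∀ R : ℝ, R₀ < R →
      ∫ ω : Metric.sphere (0 : E3) 1,
          R ^ 2 * ⟪gradient u (R • (ω : E3)), (ω : E3)⟫
          ∂((volume : Measure E3).toSphere) = 4 * π * m := by
  have hR₀' := hR₀.le
  obtain ⟨c, hc⟩ := hu.exists_flux_eq hR₀'
  let A : ℝ → ℝ := fun r =>
    ∫ ω : Metric.sphere (0 : E3) 1, u (r • (ω : E3)) ∂(volume : Measure E3).toSphere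
  have hA : ∀ r ∈ Set.Ioi R₀, HasDerivAt (fun r => A r + c * r⁻¹) 0 r := fun r hr => by
    have hr0 : r ≠ 0 := (hR₀.trans hr).ne'
    have h := (hu.hasDerivAt_integral_sphere hR₀' hr).add ((hasDerivAt_inv hr0).const_mul c)
    refine h.congr_deriv ?_
    rw [← hc r hr]
    field_simp
    ring
  obtain ⟨d, hd⟩ := isOpen_Ioi.exists_is_const_of_deriv_eq_zero isPreconnected_Ioi
    (fun r hr => (hA r hr).differentiableAt.differentiableWithinAt) fun r hr => (hA r hr).deriv
  have hlim' : Tendsto (fun r => r * (4 * π - A r)) atTop (nhds (4 * π * m)) := by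
    refine (tendsto_integral_sphere_of_tendsto_cocompact hm ?_).congr' ?_
    · filter_upwards [eventually_gt_atTop R₀] with r hr
      exact ((by fun_prop : Continuous fun ω : Metric.sphere (0 : E3) 1 => ‖r • (ω : E3)‖).mul
        (continuous_const.sub (hu.continuous_comp_smul hR₀' hr))).aestronglyMeasurable
    · filter_upwards [eventually_gt_atTop R₀] with r hr
      simp only [norm_smul_sphere (hR₀.trans hr).le]
      rw [integral_const_mul, integral_sub (integrable_const _)
        ((hu.continuous_comp_smul hR₀' hr).integrable_of_hasCompactSupport
          (HasCompactSupport.of_compactSpace _)), integral_const, toSphere_real_univ_E3]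
      simp [A]
  have heq : (fun r => r * (4 * π - A r)) =ᶠ[atTop] fun r => r * (4 * π - d) + c := by
    filter_upwards [eventually_gt_atTop R₀] with r hr
    have hr0 : r ≠ 0 := (hR₀.trans hr).ne'
    rw [← hd r hr]
    field_simp
    ring
  replace hlim' := hlim'.congr' heq
  have hd0 : 4 * π - d = 0 := by
    have h := (hlim'.sub_const c).mul tendsto_inv_atTop_zero
    rw [mul_zero] at h
    refine tendsto_nhds_unique (tendsto_const_nhds.congr' ?_) h
    filter_upwards [eventually_ne_atTop 0] with r hr
    field_simp
    ring
  simp only [hd0, mul_zero, zero_add] at hlim'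
  intro R hR
  simp only [inner_gradient_left, integral_const_mul]
  rw [hc R hR]
  exact tendsto_nhds_unique tendsto_const_nhds hlim'
end
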